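/- arXiv:1510.02864 — 7 statements merged into one kernel-verified Lean document; each statement's English description precedes it below -/
import Mathlib

section
/- Suppose (a°, b°) with a° = (u1,v1) and b° = (u2,v2) is an optimal pure strategy pair over the whole plane, i.e. a saddle point: K(a°, b) ≤ K(a°, b°) ≤ K(a, b°) for all a, b ∈ ℝ². Then u2 ≥ 0, v2 ≥ 0, u1 ≤ 0 and v1 ≤ 0. -/
open MeasureTheory ProbabilityTheory Real

/-- The bivariate normal measure on ℝ × ℝ with mean (0,0), standard deviations
`sx, sy` and correlation `ρ`, realized as the pushforward of two independent
standard gaussians. -/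
noncomputable def binormal (sx sy ρ : ℝ) : Measure (ℝ × ℝ) :=
  Measure.map (fun z : ℝ × ℝ => (sx * z.1, sy * (ρ * z.1 + Real.sqrt (1 - ρ ^ 2) * z.2)))
    ((gaussianReal 0 1).prod (gaussianReal 0 1))

/-- The set of points strictly closer (in Euclidean distance) to `a` than to `b`. -/
def closerTo (a b : ℝ × ℝ) : Set (ℝ × ℝ) :=
  {p | (p.1 - a.1) ^ 2 + (p.2 - a.2) ^ 2 < (p.1 - b.1) ^ 2 + (p.2 - b.2) ^ 2}

/-- The expected payoff (from Player I to Player II) when Player I offers `a`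
and Player II offers `b`. -/
noncomputable def K (sx sy ρ : ℝ) (a b : ℝ × ℝ) : ℝ :=
  if a = b then a.1 + a.2
  else (a.1 + a.2) * ((binormal sx sy ρ) (closerTo a b)).toReal
    + (b.1 + b.2) * ((binormal sx sy ρ) (closerTo b a)).toReal

lemma measurable_binormal_map (sx sy ρ : ℝ) : Measurable (fun z : ℝ × ℝ =>
    (sx * z.1, sy * (ρ * z.1 + Real.sqrt (1 - ρ ^ 2) * z.2))) := by
  fun_prop

lemma isOpen_closerTo (a b : ℝ × ℝ) : IsOpen (closerTo a b) :=
  isOpen_lt (by fun_prop) (by fun_prop)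

instance isProbabilityMeasure_binormal (sx sy ρ : ℝ) :
    IsProbabilityMeasure (binormal sx sy ρ) :=
  Measure.isProbabilityMeasure_map (measurable_binormal_map sx sy ρ).aemeasurable

lemma map_neg_stdGaussian_prod :
    Measure.map (fun z : ℝ × ℝ => -z) ((gaussianReal 0 1).prod (gaussianReal 0 1)) =
      (gaussianReal 0 1).prod (gaussianReal 0 1) := by
  have h : Measure.map (fun x : ℝ => -x) (gaussianReal 0 1) = gaussianReal 0 1 := by
    simp [gaussianReal_map_neg]
  have hp := Measure.map_prod_map (gaussianReal 0 1) (gaussianReal 0 1)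
    (measurable_neg (G := ℝ)) (measurable_neg (G := ℝ))
  change (Measure.map (fun x : ℝ => -x) (gaussianReal 0 1)).prod
    (Measure.map (fun x : ℝ => -x) (gaussianReal 0 1)) = _ at hp
  rw [h] at hp
  exact hp.symm

lemma map_neg_binormal (sx sy ρ : ℝ) :
    Measure.map (fun p : ℝ × ℝ => -p) (binormal sx sy ρ) = binormal sx sy ρ := by
  have hf := measurable_binormal_map sx sy ρ
  conv_rhs => rw [binormal, ← map_neg_stdGaussian_prod]
  rw [binormal, Measure.map_map (by fun_prop) hf, Measure.map_map hf (by fun_prop)]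
  congr 1
  ext z
  · simp
  · simp; ring

/-- Points at equal distance from the origin capture equal mass. -/
lemma binormal_closerTo_comm (sx sy ρ : ℝ) {a b : ℝ × ℝ}
    (h : a.1 ^ 2 + a.2 ^ 2 = b.1 ^ 2 + b.2 ^ 2) :
    binormal sx sy ρ (closerTo b a) = binormal sx sy ρ (closerTo a b) := by
  conv_lhs => rw [← map_neg_binormal]
  rw [Measure.map_apply (by fun_prop) (isOpen_closerTo b a).measurableSet]
  congr 1
  ext p
  simp only [closerTo, Set.mem_preimage, Set.mem_ofPred_eq, Prod.fst_neg, Prod.snd_neg]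
  constructor <;> intro hp <;> linarith

lemma isOpenPosMeasure_gaussianReal (μ : ℝ) {v : NNReal} (hv : v ≠ 0) :
    (gaussianReal μ v).IsOpenPosMeasure :=
  (gaussianReal_absolutelyContinuous' μ hv).isOpenPosMeasure

lemma binormal_closerTo_pos {sx sy ρ : ℝ} (hsx : 0 < sx) (hsy : 0 < sy)
    (hρ : ρ ∈ Set.Ioo (-1 : ℝ) 1) {a b : ℝ × ℝ} (hab : a ≠ b) :
    0 < (binormal sx sy ρ (closerTo a b)).toReal := by
  have := isOpenPosMeasure_gaussianReal 0 one_ne_zero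
  refine ENNReal.toReal_pos ?_ (measure_ne_top _ _)
  rw [binormal, Measure.map_apply (measurable_binormal_map sx sy ρ)
    (isOpen_closerTo a b).measurableSet]
  have hs : Real.sqrt (1 - ρ ^ 2) ≠ 0 :=
    (Real.sqrt_pos.mpr (by nlinarith [hρ.1, hρ.2])).ne'
  refine IsOpen.measure_ne_zero _ ((isOpen_closerTo a b).preimage (by fun_prop))
    ⟨(a.1 / sx, (a.2 / sy - ρ * (a.1 / sx)) / Real.sqrt (1 - ρ ^ 2)), ?_⟩
  have h1 : sx * (a.1 / sx) = a.1 := by field_simp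
  have h2 : sy * (ρ * (a.1 / sx) + Real.sqrt (1 - ρ ^ 2) *
      ((a.2 / sy - ρ * (a.1 / sx)) / Real.sqrt (1 - ρ ^ 2))) = a.2 := by
    rw [mul_div_cancel₀ _ hs]
    field_simp
    ring
  simp only [closerTo, Set.mem_preimage, Set.mem_ofPred_eq, h1, h2, sub_self]
  by_contra! hle
  refine hab (Prod.ext ?_ ?_) <;>
    nlinarith [sq_nonneg (a.1 - b.1), sq_nonneg (a.2 - b.2)]

lemma K_eq_mul {sx sy ρ : ℝ} {a b : ℝ × ℝ} (hab : a ≠ b)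
    (h : a.1 ^ 2 + a.2 ^ 2 = b.1 ^ 2 + b.2 ^ 2) :
    K sx sy ρ a b =
      (a.1 + a.2 + (b.1 + b.2)) * (binormal sx sy ρ (closerTo a b)).toReal := by
  rw [K, if_neg hab, binormal_closerTo_comm sx sy ρ h, ← add_mul]

lemma K_neg_right (sx sy ρ : ℝ) (a : ℝ × ℝ) : K sx sy ρ a (-a) = 0 := by
  by_cases h : a = -a
  · have h1 : a.1 = -a.1 := congrArg Prod.fst h
    have h2 : a.2 = -a.2 := congrArg Prod.snd h
    rw [K, if_pos h]
    linarith
  · rw [K_eq_mul h (by simp)]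
    simp only [Prod.fst_neg, Prod.snd_neg]
    ring

lemma K_self (sx sy ρ : ℝ) (a : ℝ × ℝ) : K sx sy ρ a a = a.1 + a.2 := if_pos rfl

theorem saddle_signs (sx sy ρ : ℝ) (hsx : 0 < sx) (hsy : 0 < sy)
    (hρ : ρ ∈ Set.Ioo (-1 : ℝ) 1) (a₀ b₀ : ℝ × ℝ)
    (hsaddle : ∀ a b : ℝ × ℝ, K sx sy ρ a₀ b ≤ K sx sy ρ a₀ b₀ ∧
      K sx sy ρ a₀ b₀ ≤ K sx sy ρ a b₀) :
    0 ≤ b₀.1 ∧ 0 ≤ b₀.2 ∧ a₀.1 ≤ 0 ∧ a₀.2 ≤ 0 := by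
  have hw0 : 0 ≤ K sx sy ρ a₀ b₀ := (K_neg_right sx sy ρ a₀) ▸ (hsaddle a₀ (-a₀)).1
  have hw1 : K sx sy ρ a₀ b₀ ≤ 0 := by
    have h := K_neg_right sx sy ρ (-b₀)
    rw [neg_neg] at h
    exact h ▸ (hsaddle (-b₀) b₀).2
  have hb : ∀ a, 0 ≤ K sx sy ρ a b₀ := fun a => hw0.trans (hsaddle a b₀).2
  have ha : ∀ b, K sx sy ρ a₀ b ≤ 0 := fun b => (hsaddle a₀ b).1.trans hw1
  have ht : 0 ≤ b₀.1 + b₀.2 := K_self sx sy ρ b₀ ▸ hb b₀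
  have hs : a₀.1 + a₀.2 ≤ 0 := K_self sx sy ρ a₀ ▸ ha a₀
  have hb' : ∀ a, a ≠ b₀ → a.1 ^ 2 + a.2 ^ 2 = b₀.1 ^ 2 + b₀.2 ^ 2 →
      0 ≤ a.1 + a.2 + (b₀.1 + b₀.2) := fun a hne h =>
    nonneg_of_mul_nonneg_left (K_eq_mul (sx := sx) (sy := sy) (ρ := ρ) hne h ▸ hb a)
      (binormal_closerTo_pos hsx hsy hρ hne)
  have ha' : ∀ b, a₀ ≠ b → a₀.1 ^ 2 + a₀.2 ^ 2 = b.1 ^ 2 + b.2 ^ 2 →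
      a₀.1 + a₀.2 + (b.1 + b.2) ≤ 0 := fun b hne h =>
    nonpos_of_mul_nonpos_left (K_eq_mul (sx := sx) (sy := sy) (ρ := ρ) hne h ▸ ha b)
      (binormal_closerTo_pos hsx hsy hρ hne)
  refine ⟨?_, ?_, ?_, ?_⟩ <;> by_contra! hlt
  · have := hb' (b₀.1, -b₀.2) (fun h => by have := congrArg Prod.snd h; simp only at this; linarith)
      (by ring)
    simp only at this
    linarith
  · have := hb' (-b₀.1, b₀.2) (fun h => by have := congrArg Prod.fst h; simp only at this; linarith)
      (by ring)
    simp only at this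
    linarith
  · have := ha' (a₀.1, -a₀.2) (fun h => by have := congrArg Prod.snd h; simp only at this; linarith)
      (by ring)
    simp only at this
    linarith
  · have := ha' (-a₀.1, a₀.2) (fun h => by have := congrArg Prod.fst h; simp only at this; linarith)
      (by ring)
    simp only at this
    linarith
end

section
/- Assume ρ > max{−(σx² + 3σy²)/(4σxσy), −(3σx² + σy²)/(4σxσy)}. Then the pair (a*, b*) is a local equilibrium: there exists ε > 0 such that K(a, b*) > K(a*, b*) = 0 for every a ∈ ℝ² with 0 < ‖a − a*‖ < ε, and K(a*, b) < 0 for every b ∈ ℝ² with 0 < ‖b − b*‖ < ε. -/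
open MeasureTheory ProbabilityTheory Real

/-- The common optimal offer magnitude. -/
noncomputable def cstar (sx sy ρ : ℝ) : ℝ :=
  Real.sqrt (2 * Real.pi * (sx ^ 2 + 2 * ρ * sx * sy + sy ^ 2)) / 4

/-- The cumulative distribution function of the standard normal law. -/
noncomputable def stdNormalCDF (t : ℝ) : ℝ := (gaussianReal 0 1).real (Set.Iio t)

lemma stdNormalCDF_neg (t : ℝ) : stdNormalCDF (-t) = 1 - stdNormalCDF t := by
  have := nullSingletonClass_gaussianReal (μ := 0) (v := 1) one_ne_zero
  have h : (gaussianReal 0 1).real (Set.Iio (-t)) = (gaussianReal 0 1).real (Set.Ici t) := by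
    rw [measureReal_congr Ioi_ae_eq_Ici.symm]
    conv_rhs => rw [← neg_zero (G := ℝ), ← gaussianReal_map_neg,
      map_measureReal_apply (by fun_prop) measurableSet_Ioi]
    congr 1
    ext x
    simp
  rw [stdNormalCDF, stdNormalCDF, h, ← Set.compl_Iio, probReal_compl_eq_one_sub measurableSet_Iio]

lemma stdNormalCDF_zero : stdNormalCDF 0 = 1 / 2 := by
  have h := stdNormalCDF_neg 0
  rw [neg_zero] at h
  linarith

lemma stdNormalCDF_sub (t : ℝ) :
    stdNormalCDF t - stdNormalCDF 0 = ∫ x in (0 : ℝ)..t, gaussianPDFReal 0 1 x := by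
  have := nullSingletonClass_gaussianReal (μ := 0) (v := 1) one_ne_zero
  have h (a : ℝ) : stdNormalCDF a = ∫ x in Set.Iic a, gaussianPDFReal 0 1 x := by
    rw [stdNormalCDF, measureReal_congr Iio_ae_eq_Iic, measureReal_def,
      gaussianReal_apply_eq_integral _ one_ne_zero, ENNReal.toReal_ofReal]
    exact integral_nonneg (gaussianPDFReal_nonneg _ _)
  rw [h, h, intervalIntegral.integral_Iic_sub_Iic] <;>
    exact (integrable_gaussianPDFReal _ _).integrableOn

lemma abs_stdNormalCDF_sub_le (t : ℝ) :
    |stdNormalCDF t - 1 / 2 - t * (√(2 * π))⁻¹| ≤ |t| ^ 3 := by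
  have hk : (√(2 * π))⁻¹ ≤ 1 := by
    apply inv_le_one_of_one_le₀
    rw [Real.one_le_sqrt]
    linarith [Real.pi_gt_three]
  have hk0 : 0 ≤ (√(2 * π))⁻¹ := by positivity
  have hint : stdNormalCDF t - 1 / 2 - t * (√(2 * π))⁻¹
      = ∫ x in (0 : ℝ)..t, (gaussianPDFReal 0 1 x - (√(2 * π))⁻¹) := by
    rw [intervalIntegral.integral_sub (integrable_gaussianPDFReal _ _).intervalIntegrable
      intervalIntegrable_const, ← stdNormalCDF_sub, stdNormalCDF_zero]
    simp only [intervalIntegral.integral_const, smul_eq_mul, sub_zero]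
  have hb := intervalIntegral.norm_integral_le_of_norm_le_const (a := 0) (b := t) (C := |t| ^ 2)
    (f := fun x => gaussianPDFReal 0 1 x - (√(2 * π))⁻¹) (by
      intro x hx
      have hxt : x ^ 2 ≤ |t| ^ 2 := by
        rw [sq_abs, sq_le_sq]
        rcases Set.mem_uIoc.1 hx with h | h
        · rw [abs_of_pos h.1, abs_of_pos (h.1.trans_le h.2)]; exact h.2
        · rw [abs_of_nonpos h.2, abs_of_neg (h.1.trans_le h.2)]; linarith [h.1]
      have h1 := Real.add_one_le_exp (-x ^ 2 / 2)
      have h2 : rexp (-x ^ 2 / 2) ≤ 1 := Real.exp_le_one_iff.2 (by nlinarith [sq_nonneg x])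
      have h3 : gaussianPDFReal 0 1 x = (√(2 * π))⁻¹ * rexp (-x ^ 2 / 2) := by
        simp [gaussianPDFReal]
      rw [h3, Real.norm_eq_abs, abs_le]
      constructor <;> nlinarith [sq_nonneg x])
  rw [hint]
  simpa [pow_succ] using hb

lemma map_linear_prod_gaussianReal {α β : ℝ} (h : α ^ 2 + β ^ 2 = 1) :
    ((gaussianReal 0 1).prod (gaussianReal 0 1)).map (fun z : ℝ × ℝ => α * z.1 + β * z.2)
      = gaussianReal 0 1 := by
  have hα : ((gaussianReal 0 1).prod (gaussianReal 0 1)).map (fun z : ℝ × ℝ => α * z.1)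
      = gaussianReal (α * 0) (.mk (α ^ 2) (sq_nonneg _) * 1) := by
    rw [← gaussianReal_map_const_mul, ← Function.comp_def (α * ·),
      ← Measure.map_map (by fun_prop) (by fun_prop), Measure.map_fst_prod]
    simp
  have hβ : ((gaussianReal 0 1).prod (gaussianReal 0 1)).map (fun z : ℝ × ℝ => β * z.2)
      = gaussianReal (β * 0) (.mk (β ^ 2) (sq_nonneg _) * 1) := by
    rw [← gaussianReal_map_const_mul, ← Function.comp_def (β * ·),
      ← Measure.map_map (by fun_prop) (by fun_prop), Measure.map_snd_prod]
    simp
  have hi := indepFun_prod (μ := gaussianReal 0 1) (ν := gaussianReal 0 1)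
    (X := (α * ·)) (Y := (β * ·)) (by fun_prop) (by fun_prop)
  have := gaussianReal_add_gaussianReal_of_indepFun hi hα hβ
  convert! this using 2
  · simp
  · apply NNReal.coe_injective
    simp [h]

/-- The variance of `d.1 * X + d.2 * Y` when `(X, Y)` has law `binormal sx sy ρ`. -/
def linearVariance (sx sy ρ : ℝ) (d : ℝ × ℝ) : ℝ :=
  sx ^ 2 * d.1 ^ 2 + 2 * (ρ * sx * sy) * d.1 * d.2 + sy ^ 2 * d.2 ^ 2

section Payoff

variable {sx sy ρ : ℝ}

lemma linearVariance_pos (hsx : 0 < sx) (hsy : 0 < sy) (hρ : ρ ∈ Set.Ioo (-1 : ℝ) 1)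
    {d : ℝ × ℝ} (hd : d ≠ 0) : 0 < linearVariance sx sy ρ d := by
  have h1 : 0 < 1 - ρ ^ 2 := by nlinarith [hρ.1, hρ.2]
  have h2 : linearVariance sx sy ρ d
      = (sx * d.1 + ρ * sy * d.2) ^ 2 + (1 - ρ ^ 2) * (sy * d.2) ^ 2 := by
    rw [linearVariance]; ring
  rw [h2]
  by_cases h : d.2 = 0
  · have h3 : d.1 ≠ 0 := fun h' => hd (Prod.ext h' h)
    rw [h]
    have : 0 < (sx * d.1) ^ 2 := by positivity
    simpa using this
  · have : 0 < (sy * d.2) ^ 2 := by positivity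
    positivity

lemma binormal_closerTo (hsx : 0 < sx) (hsy : 0 < sy) (hρ : ρ ∈ Set.Ioo (-1 : ℝ) 1)
    {a b : ℝ × ℝ} (hab : a ≠ b) :
    ((binormal sx sy ρ) (closerTo a b)).toReal
      = stdNormalCDF ((b.1 ^ 2 + b.2 ^ 2 - (a.1 ^ 2 + a.2 ^ 2))
          / (2 * √(linearVariance sx sy ρ (b - a)))) := by
  have hv := linearVariance_pos hsx hsy hρ (sub_ne_zero.2 hab.symm)
  set s := √(linearVariance sx sy ρ (b - a))
  have hs0 : 0 < s := Real.sqrt_pos.2 hv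
  have hs2 : s ^ 2 = linearVariance sx sy ρ (b - a) := Real.sq_sqrt hv.le
  have hr : √(1 - ρ ^ 2) ^ 2 = 1 - ρ ^ 2 := Real.sq_sqrt (by nlinarith [hρ.1, hρ.2])
  have hmeas : MeasurableSet (closerTo a b) :=
    measurableSet_lt (by fun_prop) (by fun_prop)
  have hunit : ((sx * (b.1 - a.1) + sy * ρ * (b.2 - a.2)) / s) ^ 2
      + (sy * √(1 - ρ ^ 2) * (b.2 - a.2) / s) ^ 2 = 1 := by
    rw [div_pow, div_pow, ← add_div, div_eq_one_iff_eq (by positivity), hs2, mul_pow, mul_pow, hr]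
    simp only [linearVariance, Prod.fst_sub, Prod.snd_sub]
    ring
  rw [stdNormalCDF, ← map_linear_prod_gaussianReal hunit,
    map_measureReal_apply (by fun_prop) measurableSet_Iio, binormal,
    Measure.map_apply (by fun_prop) hmeas, measureReal_def]
  congr 2
  ext z
  simp only [closerTo, Set.mem_preimage, Set.mem_ofPred_eq, Set.mem_Iio]
  have h : (sx * (b.1 - a.1) + sy * ρ * (b.2 - a.2)) / s * z.1
      + sy * √(1 - ρ ^ 2) * (b.2 - a.2) / s * z.2
      = (2 * ((sx * z.1) * (b.1 - a.1)
          + (sy * (ρ * z.1 + √(1 - ρ ^ 2) * z.2)) * (b.2 - a.2))) / (2 * s) := by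
    field_simp
    ring
  rw [h, div_lt_div_iff_of_pos_right (by positivity)]
  constructor <;> intro h' <;> nlinarith

lemma K_eq (hsx : 0 < sx) (hsy : 0 < sy) (hρ : ρ ∈ Set.Ioo (-1 : ℝ) 1)
    {a b : ℝ × ℝ} (hab : a ≠ b) :
    K sx sy ρ a b = (b.1 + b.2) - (b.1 + b.2 - (a.1 + a.2)) *
      stdNormalCDF ((b.1 ^ 2 + b.2 ^ 2 - (a.1 ^ 2 + a.2 ^ 2))
          / (2 * √(linearVariance sx sy ρ (b - a)))) := by
  rw [K, if_neg hab, binormal_closerTo hsx hsy hρ hab, binormal_closerTo hsx hsy hρ hab.symm]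
  have h1 : linearVariance sx sy ρ (a - b) = linearVariance sx sy ρ (b - a) := by
    simp only [linearVariance, Prod.fst_sub, Prod.snd_sub]
    ring
  have h2 : (a.1 ^ 2 + a.2 ^ 2 - (b.1 ^ 2 + b.2 ^ 2)) / (2 * √(linearVariance sx sy ρ (a - b)))
      = -((b.1 ^ 2 + b.2 ^ 2 - (a.1 ^ 2 + a.2 ^ 2))
        / (2 * √(linearVariance sx sy ρ (b - a)))) := by
    rw [h1, ← neg_div, neg_sub]
  rw [h2, stdNormalCDF_neg]
  ring

lemma K_neg_swap (hsx : 0 < sx) (hsy : 0 < sy) (hρ : ρ ∈ Set.Ioo (-1 : ℝ) 1) (a b : ℝ × ℝ) :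
    K sx sy ρ (-b) (-a) = -K sx sy ρ a b := by
  by_cases hab : a = b
  · subst hab
    simp [K]
    ring
  · have hab' : -b ≠ -a := fun h => hab (neg_injective h).symm
    rw [K_eq hsx hsy hρ hab, K_eq hsx hsy hρ hab', neg_sub_neg]
    have h2 : ((-a).1 ^ 2 + (-a).2 ^ 2 - ((-b).1 ^ 2 + (-b).2 ^ 2))
          / (2 * √(linearVariance sx sy ρ (b - a)))
        = -((b.1 ^ 2 + b.2 ^ 2 - (a.1 ^ 2 + a.2 ^ 2))
          / (2 * √(linearVariance sx sy ρ (b - a)))) := by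
      rw [← neg_div]
      simp
    rw [h2, stdNormalCDF_neg]
    simp only [Prod.fst_neg, Prod.snd_neg]
    ring

end Payoff

open Filter Topology Asymptotics in
lemma isBigO_inv_sqrt_one_add :
    (fun x : ℝ => (√(1 + x))⁻¹ - (1 - x / 2)) =O[𝓝 0] fun x => x ^ 2 := by
  refine IsBigO.of_bound 1 ?_
  filter_upwards [Ioo_mem_nhds (show (-1 / 2 : ℝ) < 0 by norm_num) one_pos] with x hx
  have hr : 0 < √(1 + x) := Real.sqrt_pos.2 (by linarith [hx.1])
  have hr2 : √(1 + x) ^ 2 = 1 + x := Real.sq_sqrt (by linarith [hx.1])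
  have hr3 : 7 / 10 ≤ √(1 + x) := Real.le_sqrt_of_sq_le (by linarith [hx.1])
  generalize √(1 + x) = r at *
  obtain rfl : x = r ^ 2 - 1 := by linarith
  have h : r⁻¹ - (1 - (r ^ 2 - 1) / 2) = (r - 1) ^ 2 * ((r + 2) / (2 * r)) := by
    field_simp
    ring
  have h2 : (r + 2) / (2 * r) ≤ (r + 1) ^ 2 := by
    rw [div_le_iff₀ (by positivity)]
    nlinarith [mul_pos hr hr, mul_pos hr (mul_pos hr hr)]
  rw [h, one_mul, Real.norm_of_nonneg (by positivity), Real.norm_of_nonneg (by positivity)]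
  calc (r - 1) ^ 2 * ((r + 2) / (2 * r)) ≤ (r - 1) ^ 2 * (r + 1) ^ 2 := by gcongr
    _ = (r ^ 2 - 1) ^ 2 := by ring

open Filter Topology Asymptotics in
/-- Second-order expansion of the payoff loss caused by a deviation `p` from the offer `(c, c)`. -/
lemma isBigO_payoff_expansion {c S P Q R : ℝ} (hc : 0 < c) (hS : 0 < S)
    (hPQR : P + 2 * R + Q = S ^ 2) {g : ℝ → ℝ}
    (hg : ∀ t, |g t - t * (S / (4 * c))| ≤ |t| ^ 3) :
    (fun p : ℝ × ℝ =>
      g ((2 * c * (p.1 + p.2) + p.1 ^ 2 + p.2 ^ 2) / (2 * √(P * (2 * c + p.1) ^ 2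
        + 2 * R * (2 * c + p.1) * (2 * c + p.2) + Q * (2 * c + p.2) ^ 2)))
          * (4 * c + (p.1 + p.2)) - (p.1 + p.2) / 2
        - ((3 * S ^ 2 - 2 * (P + R)) * p.1 ^ 2 + (3 * S ^ 2 - 2 * (Q + R)) * p.2 ^ 2)
          / (8 * c * S ^ 2))
      =O[𝓝 0] fun p => ‖p‖ ^ 3 := by
  have hu : (fun p : ℝ × ℝ => p.1) =O[𝓝 0] fun p => ‖p‖ :=
    IsBigO.of_norm_le fun p => norm_fst_le p
  have hw : (fun p : ℝ × ℝ => p.2) =O[𝓝 0] fun p => ‖p‖ :=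
    IsBigO.of_norm_le fun p => norm_snd_le p
  have hN : Tendsto (fun p : ℝ × ℝ => ‖p‖) (𝓝 0) (𝓝 0) := tendsto_norm_zero
  have h1 {m n : ℕ} (h : m ≤ n) :
      (fun p : ℝ × ℝ => ‖p‖ ^ n) =O[𝓝 0] fun p => ‖p‖ ^ m := by
    obtain ⟨k, rfl⟩ := Nat.exists_eq_add_of_le h
    simp_rw [pow_add]
    simpa using (isBigO_refl (fun p : ℝ × ℝ => ‖p‖ ^ m) (𝓝 0)).mul
      ((hN.pow k).isBigO_one ℝ)
  have hq := hu.add hw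
  have hr : (fun p : ℝ × ℝ => p.1 ^ 2 + p.2 ^ 2) =O[𝓝 0] fun p => ‖p‖ ^ 2 :=
    (hu.pow 2).add (hw.pow 2)
  have hv : (fun p : ℝ × ℝ => (P * p.1 ^ 2 + 2 * R * (p.1 * p.2) + Q * p.2 ^ 2)
      / (4 * c ^ 2 * S ^ 2)) =O[𝓝 0] fun p => ‖p‖ ^ 2 := by
    have h := ((((hu.pow 2).const_mul_left P).add
      (((hu.mul hw).congr_right fun p => (sq ‖p‖).symm).const_mul_left (2 * R))).add
        ((hw.pow 2).const_mul_left Q)).const_mul_left (4 * c ^ 2 * S ^ 2)⁻¹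
    exact h.congr_left fun p => by rw [div_eq_inv_mul]
  have hl : (fun p : ℝ × ℝ => ((P + R) * p.1 + (Q + R) * p.2) / (c * S ^ 2))
      =O[𝓝 0] fun p => ‖p‖ := by
    have h := ((hu.const_mul_left (P + R)).add (hw.const_mul_left (Q + R))).const_mul_left
      (c * S ^ 2)⁻¹
    exact h.congr_left fun p => by rw [div_eq_inv_mul]
  set q : ℝ × ℝ → ℝ := fun p => p.1 + p.2 with hq_def
  set r : ℝ × ℝ → ℝ := fun p => p.1 ^ 2 + p.2 ^ 2 with hr_def
  set l : ℝ × ℝ → ℝ := fun p => ((P + R) * p.1 + (Q + R) * p.2) / (c * S ^ 2) with hl_def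
  set v : ℝ × ℝ → ℝ := fun p => (P * p.1 ^ 2 + 2 * R * (p.1 * p.2) + Q * p.2 ^ 2)
      / (4 * c ^ 2 * S ^ 2) with hv_def
  have hN2 : (fun p : ℝ × ℝ => ‖p‖ ^ 2) =O[𝓝 0] fun p => ‖p‖ := by
    simpa using h1 one_le_two
  have hx : (fun p => l p + v p) =O[𝓝 0] fun p => ‖p‖ := hl.add (hv.trans hN2)
  have hx0 : Tendsto (fun p => l p + v p) (𝓝 0) (𝓝 0) := hx.trans_tendsto hN
  set y : ℝ × ℝ → ℝ := fun p => (√(1 + (l p + v p)))⁻¹ - (1 - (l p + v p) / 2) with hy_def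
  have hy : y =O[𝓝 0] fun p => ‖p‖ ^ 2 :=
    (isBigO_inv_sqrt_one_add.comp_tendsto hx0).trans (hx.pow 2)
  have hnum : (fun p => 2 * c * q p + r p) =O[𝓝 0] fun p => ‖p‖ :=
    (hq.const_mul_left _).add (hr.trans hN2)
  have hfac : (fun p => 4 * c + q p) =O[𝓝 0] fun _ => (1 : ℝ) :=
    (isBigO_const_const _ one_ne_zero _).add (hq.trans (hN.isBigO_one ℝ))
  set t : ℝ × ℝ → ℝ := fun p => (2 * c * (p.1 + p.2) + p.1 ^ 2 + p.2 ^ 2)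
    / (2 * √(P * (2 * c + p.1) ^ 2 + 2 * R * (2 * c + p.1) * (2 * c + p.2)
      + Q * (2 * c + p.2) ^ 2)) with ht_def
  have ht_eq (p) : t p = (2 * c * q p + r p) * (√(1 + (l p + v p)))⁻¹ * (4 * c * S)⁻¹ := by
    have h : P * (2 * c + p.1) ^ 2 + 2 * R * (2 * c + p.1) * (2 * c + p.2)
        + Q * (2 * c + p.2) ^ 2 = (2 * c * S) ^ 2 * (1 + (l p + v p)) := by
      simp only [hl_def, hv_def]
      field_simp
      rw [← hPQR]
      ring
    rw [ht_def]
    simp only [h]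
    rw [Real.sqrt_mul (sq_nonneg _), Real.sqrt_sq (by positivity), div_eq_mul_inv, mul_inv,
      mul_inv, mul_inv, mul_inv, mul_inv]
    simp only [hq_def, hr_def]
    ring
  have hinv : (fun p => (√(1 + (l p + v p)))⁻¹) =O[𝓝 0] fun _ => (1 : ℝ) := by
    have h : Tendsto (fun p => (√(1 + (l p + v p)))⁻¹) (𝓝 0) (𝓝 (√(1 + 0))⁻¹) :=
      ((hx0.const_add 1).sqrt).inv₀ (by simp)
    exact h.isBigO_one ℝ
  have ht : t =O[𝓝 0] fun p => ‖p‖ := by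
    have h := (hnum.mul hinv).const_mul_left (4 * c * S)⁻¹
    refine (h.congr_left fun p => ?_).congr_right fun p => mul_one _
    rw [ht_eq]
    ring
  have he : (fun p => g (t p) - t p * (S / (4 * c))) =O[𝓝 0] fun p => ‖p‖ ^ 3 := by
    refine IsBigO.trans ?_ (ht.pow 3)
    exact isBigO_of_le _ fun p => by
      simpa only [norm_pow, Real.norm_eq_abs] using hg (t p)
  have e1 := (he.mul hfac).congr_right fun p => mul_one _
  have e2 := (((hnum.mul hfac).mul hy).congr_right
    fun p => show ‖p‖ * 1 * ‖p‖ ^ 2 = ‖p‖ ^ 3 by ring).const_mul_left (16 * c ^ 2)⁻¹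
  have hone : (fun p => 1 - (l p + v p) / 2) =O[𝓝 0] fun _ => (1 : ℝ) :=
    ((hx0.div_const 2).const_sub 1).isBigO_one ℝ
  have e3 := ((hq.mul hr).mul hone).congr_right
    fun p => show ‖p‖ * ‖p‖ ^ 2 * 1 = ‖p‖ ^ 3 by ring
  have e4 := ((hr.const_mul_left (4 * c)).add ((hq.pow 2).const_mul_left (2 * c))).mul hx
  have e5 := (hq.mul hv).congr_right fun p => show ‖p‖ * ‖p‖ ^ 2 = ‖p‖ ^ 3 by ring
  have e6 := ((e3.sub ((e4.congr_right fun p => show ‖p‖ ^ 2 * ‖p‖ = ‖p‖ ^ 3 by ring).const_mul_left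
    (1 / 2))).sub (e5.const_mul_left (4 * c ^ 2))).const_mul_left (16 * c ^ 2)⁻¹
  refine ((e1.add e2).add e6).congr_left fun p => ?_
  have ht' : t p = (2 * c * q p + r p) * (y p + (1 - (l p + v p) / 2)) * (4 * c * S)⁻¹ := by
    rw [ht_eq, hy_def]
    ring
  have hmain : t p * (S / (4 * c)) * (4 * c + q p)
      = (2 * c * q p + r p) * (4 * c + q p) * (y p + (1 - (l p + v p) / 2)) * (16 * c ^ 2)⁻¹ := by
    rw [ht']
    field_simp
    ring
  have hquad : ((3 * S ^ 2 - 2 * (P + R)) * p.1 ^ 2 + (3 * S ^ 2 - 2 * (Q + R)) * p.2 ^ 2)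
          / (8 * c * S ^ 2) = (2 * r p + q p ^ 2 - 2 * c * (q p * l p)) / (8 * c) := by
    simp only [hq_def, hr_def, hl_def]
    field_simp
    rw [← hPQR]
    ring
  rw [hquad]
  have hexp : g (t p) * (4 * c + q p) = (g (t p) - t p * (S / (4 * c))) * (4 * c + q p)
      + t p * (S / (4 * c)) * (4 * c + q p) := by ring
  change _ = g (t p) * (4 * c + q p) - q p / 2 - _
  rw [hexp, hmain]
  field_simp
  ring

open Filter Topology Asymptotics in
lemma eventually_pos_of_sub_isBigO_cube {α β γ : ℝ} (hα : 0 < α) (hβ : 0 < β)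
    (hγ : 0 < γ) {F : ℝ × ℝ → ℝ}
    (hF : (fun p => F p - (α * p.1 ^ 2 + β * p.2 ^ 2) / γ) =O[𝓝 0] fun p => ‖p‖ ^ 3) :
    ∀ᶠ p in 𝓝 (0 : ℝ × ℝ), p ≠ 0 → 0 < F p := by
  have hlo : (fun p : ℝ × ℝ => ‖p‖ ^ 3) =o[𝓝 0] fun p => ‖p‖ ^ 2 := by
    exact (isLittleO_pow_pow (𝕜 := ℝ) (by norm_num : 2 < 3)).comp_tendsto tendsto_norm_zero
  have hm : 0 < min α β := lt_min hα hβ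
  filter_upwards [(hF.trans_isLittleO hlo).bound (half_pos (div_pos hm hγ))] with p hp hp0
  have hn : 0 < ‖p‖ ^ 2 := by positivity
  have hle : min α β / γ * ‖p‖ ^ 2 ≤ (α * p.1 ^ 2 + β * p.2 ^ 2) / γ := by
    rw [div_mul_eq_mul_div]
    gcongr
    have h1 := mul_le_mul_of_nonneg_right (min_le_left α β) (sq_nonneg p.1)
    have h2 := mul_le_mul_of_nonneg_right (min_le_right α β) (sq_nonneg p.2)
    have h3 := mul_nonneg hα.le (sq_nonneg p.1)
    have h4 := mul_nonneg hβ.le (sq_nonneg p.2)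
    rcases max_choice ‖p.1‖ ‖p.2‖ with h | h <;>
      rw [Prod.norm_def, h, Real.norm_eq_abs, sq_abs] <;> linarith
  rw [Real.norm_eq_abs, Real.norm_of_nonneg hn.le] at hp
  have h1 := neg_le_of_abs_le hp
  have h2 := mul_pos (div_pos hm hγ) hn
  linarith

lemma abs_fst_lt_and_abs_snd_lt_of_sqrt_lt {u w ε : ℝ} (h : √(u ^ 2 + w ^ 2) < ε) :
    |u| < ε ∧ |w| < ε :=
  ⟨(Real.abs_le_sqrt (by nlinarith [sq_nonneg w])).trans_lt h,
    (Real.abs_le_sqrt (by nlinarith [sq_nonneg u])).trans_lt h⟩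

open Filter Topology in
lemma eventually_K_neg {sx sy ρ : ℝ} (hsx : 0 < sx) (hsy : 0 < sy) (hρ : ρ ∈ Set.Ioo (-1 : ℝ) 1)
    (hx : 0 < sx ^ 2 + 3 * sy ^ 2 + 4 * (ρ * sx * sy))
    (hy : 0 < 3 * sx ^ 2 + sy ^ 2 + 4 * (ρ * sx * sy)) :
    ∀ᶠ p in 𝓝 (0 : ℝ × ℝ), p ≠ 0 →
      K sx sy ρ (-cstar sx sy ρ, -cstar sx sy ρ) ((cstar sx sy ρ, cstar sx sy ρ) + p) < 0 := by
  have hV : 0 < sx ^ 2 + 2 * ρ * sx * sy + sy ^ 2 := by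
    have h := linearVariance_pos hsx hsy hρ (d := (1, 1)) (by simp)
    simp only [linearVariance] at h
    linarith
  set S := √(sx ^ 2 + 2 * ρ * sx * sy + sy ^ 2)
  have hS : 0 < S := Real.sqrt_pos.2 hV
  have hS2 : S ^ 2 = sx ^ 2 + 2 * ρ * sx * sy + sy ^ 2 := Real.sq_sqrt hV.le
  have hc_eq : cstar sx sy ρ = √(2 * π) * S / 4 := by
    rw [cstar, Real.sqrt_mul (by positivity)]
  have hpi : 0 < √(2 * π) := by positivity
  set c := cstar sx sy ρ
  have hc : 0 < c := by rw [hc_eq]; positivity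
  have hk : S / (4 * c) = (√(2 * π))⁻¹ := by
    rw [hc_eq]
    field_simp
  have hexp := isBigO_payoff_expansion (P := sx ^ 2) (Q := sy ^ 2) (R := ρ * sx * sy)
    (g := fun t => stdNormalCDF t - 1 / 2) hc hS (by rw [hS2]; ring)
    (fun t => by rw [hk]; exact abs_stdNormalCDF_sub_le t)
  have hα : 0 < (3 * S ^ 2 - 2 * (sx ^ 2 + ρ * sx * sy)) := by
    rw [hS2]
    linarith
  have hβ : 0 < (3 * S ^ 2 - 2 * (sy ^ 2 + ρ * sx * sy)) := by
    rw [hS2]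
    linarith
  have hpos := eventually_pos_of_sub_isBigO_cube hα hβ (by positivity) hexp
  have hne : ∀ᶠ p : ℝ × ℝ in 𝓝 0, -(2 * c) < p.1 :=
    continuous_fst.continuousAt.eventually_const_lt (by simpa using hc)
  filter_upwards [hpos, hne] with p hp hp1 hp0
  have hab : ((-c, -c) : ℝ × ℝ) ≠ (c, c) + p := fun h => by
    have := congrArg Prod.fst h
    simp only [Prod.fst_add] at this
    linarith
  have h1 : linearVariance sx sy ρ ((c, c) + p - (-c, -c)) = sx ^ 2 * (2 * c + p.1) ^ 2
      + 2 * (ρ * sx * sy) * (2 * c + p.1) * (2 * c + p.2) + sy ^ 2 * (2 * c + p.2) ^ 2 := by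
    simp only [linearVariance, Prod.fst_sub, Prod.snd_sub, Prod.fst_add, Prod.snd_add]
    ring
  have h2 : ((c, c) + p).1 ^ 2 + ((c, c) + p).2 ^ 2 - ((-c) ^ 2 + (-c) ^ 2)
      = 2 * c * (p.1 + p.2) + p.1 ^ 2 + p.2 ^ 2 := by
    simp only [Prod.fst_add, Prod.snd_add]
    ring
  rw [K_eq hsx hsy hρ hab, h1, h2]
  simp only [Prod.fst_add, Prod.snd_add]
  linarith [hp hp0]

theorem local_equilibrium (sx sy ρ : ℝ) (hsx : 0 < sx) (hsy : 0 < sy)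
    (hρ : ρ ∈ Set.Ioo (-1 : ℝ) 1)
    (hρ' : ρ > max (-(sx ^ 2 + 3 * sy ^ 2) / (4 * sx * sy))
      (-(3 * sx ^ 2 + sy ^ 2) / (4 * sx * sy))) :
    let c := cstar sx sy ρ
    let astar : ℝ × ℝ := (-c, -c)
    let bstar : ℝ × ℝ := (c, c)
    K sx sy ρ astar bstar = 0 ∧
    ∃ ε > 0,
      (∀ a : ℝ × ℝ, 0 < Real.sqrt ((a.1 - astar.1) ^ 2 + (a.2 - astar.2) ^ 2) →
        Real.sqrt ((a.1 - astar.1) ^ 2 + (a.2 - astar.2) ^ 2) < ε →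
        K sx sy ρ a bstar > K sx sy ρ astar bstar) ∧
      (∀ b : ℝ × ℝ, 0 < Real.sqrt ((b.1 - bstar.1) ^ 2 + (b.2 - bstar.2) ^ 2) →
        Real.sqrt ((b.1 - bstar.1) ^ 2 + (b.2 - bstar.2) ^ 2) < ε →
        K sx sy ρ astar b < 0) := by
  intro c astar bstar
  have hneg : -bstar = astar := rfl
  have hneg' : -astar = bstar := by simp [astar, bstar]
  obtain ⟨hx, hy⟩ := max_lt_iff.1 hρ'
  rw [div_lt_iff₀ (by positivity)] at hx hy
  have hK0 : K sx sy ρ astar bstar = 0 := by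
    have h := K_neg_swap hsx hsy hρ astar bstar
    rw [hneg, hneg'] at h
    linarith
  obtain ⟨ε, hε, hball⟩ := Metric.eventually_nhds_iff.1
    (eventually_K_neg hsx hsy hρ (by linarith) (by linarith))
  have hb (b : ℝ × ℝ) (h0 : 0 < √((b.1 - bstar.1) ^ 2 + (b.2 - bstar.2) ^ 2))
      (hlt : √((b.1 - bstar.1) ^ 2 + (b.2 - bstar.2) ^ 2) < ε) : K sx sy ρ astar b < 0 := by
    have h := hball (y := b - bstar) ?_ ?_
    · rwa [add_sub_cancel] at h
    · rw [dist_zero_right, Prod.norm_def]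
      exact max_lt_iff.2 (abs_fst_lt_and_abs_snd_lt_of_sqrt_lt hlt)
    · intro h
      rw [sub_eq_zero.1 h] at h0
      simp at h0
  refine ⟨hK0, ε, hε, fun a h0 hlt => ?_, hb⟩
  have hdist : ((-a).1 - bstar.1) ^ 2 + ((-a).2 - bstar.2) ^ 2
      = (a.1 - astar.1) ^ 2 + (a.2 - astar.2) ^ 2 := by
    simp only [astar, bstar, Prod.fst_neg, Prod.snd_neg]
    ring
  have h := hb (-a) (by rwa [hdist]) (by rwa [hdist])
  rw [← hneg, K_neg_swap hsx hsy hρ] at h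
  rw [hK0]
  linarith
end

section
/- Let g, h : ℝ → ℝ with h(x) > 0 for all x. Suppose there exist x_g, x_h ∈ ℝ such that: g is monotone nondecreasing on (−∞, x_g] and monotone nonincreasing on [x_g, ∞) with g(x_g) ≥ 0; and h is monotone nonincreasing on (−∞, x_h] and monotone nondecreasing on [x_h, ∞). Then the function f = g/h attains values on the interval [min(x_g, x_h), max(x_g, x_h)] that dominate all its values: for every x ∈ ℝ there exists y ∈ [min(x_g, x_h), max(x_g, x_h)] with g(y)/h(y) ≥ g(x)/h(x). -/
theorem max_of_quotient (g h : ℝ → ℝ) (hpos : ∀ x, 0 < h x) (xg xh : ℝ)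
    (hg₁ : MonotoneOn g (Set.Iic xg)) (hg₂ : AntitoneOn g (Set.Ici xg))
    (hg₀ : 0 ≤ g xg)
    (hh₁ : AntitoneOn h (Set.Iic xh)) (hh₂ : MonotoneOn h (Set.Ici xh)) :
    ∀ x : ℝ, ∃ y ∈ Set.Icc (min xg xh) (max xg xh), g x / h x ≤ g y / h y := by
  intro x
  rcases le_total (g x) 0 with hx | hx
  · exact ⟨xg, ⟨min_le_left _ _, le_max_left _ _⟩,
      (div_nonpos_of_nonpos_of_nonneg hx (hpos x).le).trans (div_nonneg hg₀ (hpos xg).le)⟩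
  rcases le_total x (min xg xh) with hl | hl
  · have hg := hg₁ (hl.trans (min_le_left _ _)) (min_le_left xg xh) hl
    have hh := hh₁ (hl.trans (min_le_right _ _)) (min_le_right xg xh) hl
    exact ⟨_, ⟨le_rfl, min_le_max⟩, div_le_div₀ (hx.trans hg) hg (hpos _) hh⟩
  rcases le_total x (max xg xh) with hr | hr
  · exact ⟨x, ⟨hl, hr⟩, le_rfl⟩
  · have hg := hg₂ (le_max_left xg xh) ((le_max_left _ _).trans hr) hr
    have hh := hh₂ (le_max_right xg xh) ((le_max_right _ _).trans hr) hr
    exact ⟨_, ⟨min_le_max, le_rfl⟩, div_le_div₀ (hx.trans hg) hg (hpos _) hh⟩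
end

section
/- Assume ρ ∈ (0,1) and σx < σy. Let α' = σx² − ρσxσy and β' = σy² − ρσxσy. Then for every a ∈ ℝ² there exist r ≥ 0 and θ ∈ [π + arctan(α'/β'), 5π/4] such that K((c + r·cos θ, c + r·sin θ), b*) ≤ K(a, b*); that is, the payoff against b* is minimized at a point lying in the closed cone with vertex b* spanned by the directions with angle between π + arctan(α'/β') and 5π/4. -/
open MeasureTheory ProbabilityTheory Real

/-- The cumulative distribution function of the standard normal law. -/
local notation "Φ" => cdf (gaussianReal 0 1)

theorem gaussianPDFReal_zero_one (t : ℝ) :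
    gaussianPDFReal 0 1 t = (√(2 * π))⁻¹ * exp (-t ^ 2 / 2) := by
  simp [gaussianPDFReal]

theorem stdNormal_cdf_eq_integral (x : ℝ) : Φ x = ∫ t in Set.Iic x, gaussianPDFReal 0 1 t := by
  rw [cdf_eq_real, measureReal_def, gaussianReal_apply_eq_integral _ one_ne_zero,
    ENNReal.toReal_ofReal]
  exact integral_nonneg fun t => gaussianPDFReal_nonneg 0 1 t

theorem stdNormal_cdf_neg (x : ℝ) : Φ (-x) = 1 - Φ x := by
  have := nullSingletonClass_gaussianReal (μ := 0) (v := 1) one_ne_zero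
  have h : (gaussianReal 0 1).real (Set.Iic (-x)) = (gaussianReal 0 1).real (Set.Ioi x) := by
    conv_lhs => rw [← neg_zero, ← gaussianReal_map_neg]
    rw [map_measureReal_apply measurable_neg measurableSet_Iic]
    have : (fun x : ℝ => -x) ⁻¹' Set.Iic (-x) = Set.Ici x := by ext; simp
    rw [this]
    exact measureReal_congr Ioi_ae_eq_Ici.symm
  rw [cdf_eq_real, cdf_eq_real, h, ← Set.compl_Iic, probReal_compl_eq_one_sub measurableSet_Iic]

theorem stdNormal_cdf_zero : Φ 0 = 1 / 2 := by
  have h := stdNormal_cdf_neg 0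
  rw [neg_zero] at h
  linarith

/-- The Laplace law with the same density at the origin dominates the lower Gaussian tail. -/
theorem stdNormal_cdf_le_exp {x : ℝ} (hx : x ≤ 0) : Φ x ≤ exp (2 * (√(2 * π))⁻¹ * x) / 2 := by
  set k : ℝ := (√(2 * π))⁻¹ with hk
  have hk0 : 0 < k := by positivity
  have hint : ∀ z : ℝ, ∫ t in Set.Iic z, k * exp (2 * k * t) = exp (2 * k * z) / 2 := by
    intro z
    rw [integral_const_mul, integral_exp_mul_Iic (by positivity)]
    field_simp
  have hint' : ∀ z : ℝ, IntegrableOn (fun t => k * exp (2 * k * t)) (Set.Iic z) := fun z =>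
    (integrableOn_exp_mul_Iic (by positivity) z).const_mul k
  have hg := integrable_gaussianPDFReal 0 1
  rcases le_total x (-(4 * k)) with h | h
  · rw [stdNormal_cdf_eq_integral, ← hint]
    refine setIntegral_mono_on hg.integrableOn (hint' x) measurableSet_Iic fun t ht => ?_
    rw [gaussianPDFReal_zero_one]
    have ht : t ≤ x := ht
    gcongr
    nlinarith
  · have h1 := intervalIntegral.integral_Iic_sub_Iic (hg.integrableOn (s := Set.Iic x))
      (hg.integrableOn (s := Set.Iic 0))
    have h2 := intervalIntegral.integral_Iic_sub_Iic (hint' x) (hint' 0)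
    rw [hint, hint] at h2
    rw [← stdNormal_cdf_eq_integral, ← stdNormal_cdf_eq_integral, stdNormal_cdf_zero] at h1
    have h3 : ∫ t in x..0, k * exp (2 * k * t) ≤ ∫ t in x..0, gaussianPDFReal 0 1 t := by
      refine intervalIntegral.integral_mono_on hx ?_ hg.intervalIntegrable fun t ht => ?_
      · exact (by fun_prop : Continuous fun t => k * exp (2 * k * t)).intervalIntegrable _ _
      · rw [gaussianPDFReal_zero_one]
        obtain ⟨h4, h5⟩ := ht
        gcongr
        nlinarith
    simp only [mul_zero, exp_zero] at h2
    linarith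

theorem stdNormal_cdf_neg_mul_sq_le {y : ℝ} (hy : 0 ≤ y) :
    Φ (-y) * (2 * (1 + (√(2 * π))⁻¹ * y) ^ 2) ≤ 1 := by
  set k : ℝ := (√(2 * π))⁻¹ with hk
  have hk0 : 0 < k := by positivity
  have h1 : Φ (-y) ≤ exp (2 * k * -y) / 2 := stdNormal_cdf_le_exp (by linarith)
  have h2 : (1 + k * y) ^ 2 ≤ exp (k * y) ^ 2 := by
    gcongr
    linarith [add_one_le_exp (k * y)]
  calc _ ≤ exp (2 * k * -y) / 2 * (2 * exp (k * y) ^ 2) := by gcongr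
    _ = 1 := by
      rw [← exp_nat_mul, div_mul_eq_mul_div, mul_left_comm, ← exp_add]
      ring_nf
      simp

/-- The gain of a displacement with coordinate sum `m` and slope `e` is dominated by the gain of
one whose slope lies between `0` and the minimizer `B / D` of the variance
`N - 2 * B * e + D * e ^ 2`. -/
theorem exists_slope_mem_Icc {N B D c : ℝ} (hN : 0 < N) (hB : 0 < B) (hD : 0 < D) (hDN : D ≤ N)
    (hBND : B ^ 2 < N * D) (hc : c = √(2 * π * N) / 4) (m e : ℝ) (hm : 0 < m) :
    ∃ m' > 0, ∃ e' ∈ Set.Icc 0 (B / D),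
      m * Φ ((2 * c - m * (1 + e ^ 2) / 2) / √(N - 2 * B * e + D * e ^ 2)) ≤
        m' * Φ ((2 * c - m' * (1 + e' ^ 2) / 2) / √(N - 2 * B * e' + D * e' ^ 2)) := by
  have hpos : ∀ t, 0 < N - 2 * B * t + D * t ^ 2 := by
    intro t
    have : 0 < D * (N - 2 * B * t + D * t ^ 2) := by nlinarith [sq_nonneg (D * t - B)]
    exact pos_of_mul_pos_right this hD.le
  have hBD : 0 < B / D := by positivity
  have hBD' : D * (B / D) = B := by field_simp
  rcases le_total 0 (2 * c - m * (1 + e ^ 2) / 2) with hz | hz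
  · have key : ∀ e', e' ^ 2 ≤ e ^ 2 →
        N - 2 * B * e' + D * e' ^ 2 ≤ N - 2 * B * e + D * e ^ 2 →
        m * Φ ((2 * c - m * (1 + e ^ 2) / 2) / √(N - 2 * B * e + D * e ^ 2)) ≤
          m * Φ ((2 * c - m * (1 + e' ^ 2) / 2) / √(N - 2 * B * e' + D * e' ^ 2)) := by
      intro e' h1 h2
      have h3 := Real.sqrt_pos.2 (hpos e')
      refine mul_le_mul_of_nonneg_left (monotone_cdf _ ?_) hm.le
      refine div_le_div₀ ?_ ?_ h3 (Real.sqrt_le_sqrt h2) <;> nlinarith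
    rcases lt_or_ge e 0 with he | he
    · exact ⟨m, hm, 0, ⟨le_rfl, hBD.le⟩, key 0 (by nlinarith) (by nlinarith)⟩
    rcases le_or_gt e (B / D) with he' | he'
    · exact ⟨m, hm, e, ⟨he, he'⟩, le_rfl⟩
    · refine ⟨m, hm, B / D, ⟨hBD.le, le_rfl⟩, key _ (by gcongr) ?_⟩
      generalize B / D = w at *
      subst hBD'
      nlinarith [mul_nonneg hD.le (sq_nonneg (e - w))]
  · have hc0 : 0 < c := by rw [hc]; positivity
    refine ⟨4 * c, by positivity, 0, ⟨le_rfl, hBD.le⟩, ?_⟩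
    have h0 : (2 * c - 4 * c * (1 + 0 ^ 2) / 2) / √(N - 2 * B * 0 + D * 0 ^ 2) = 0 := by
      ring_nf
    rw [h0, stdNormal_cdf_zero]
    set f := |e| with hf
    have hf0 : 0 ≤ f := abs_nonneg e
    have hef : e ^ 2 = f ^ 2 := (sq_abs e).symm
    set k : ℝ := (√(2 * π))⁻¹ with hk
    have hk0 : 0 < k := by positivity
    have hsN : 0 < √N := Real.sqrt_pos.2 hN
    have hck : 4 * c * k = √N := by
      rw [hc, hk, Real.sqrt_mul (by positivity)]
      field_simp
    have hBN : B ≤ N := by nlinarith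
    have hR : √(N - 2 * B * e + D * e ^ 2) ≤ √N * (1 + f) := by
      rw [Real.sqrt_le_left (by positivity), mul_pow, Real.sq_sqrt hN.le]
      have : -e ≤ f := neg_le_abs e
      nlinarith [mul_le_mul_of_nonneg_left this hB.le, mul_le_mul_of_nonneg_right hBN hf0,
        mul_le_mul_of_nonneg_right hDN (sq_nonneg e)]
    have hR0 := Real.sqrt_pos.2 (hpos e)
    set y := (m * (1 + f ^ 2) / 2 - 2 * c) / (√N * (1 + f)) with hy
    have hnum : 0 ≤ m * (1 + f ^ 2) / 2 - 2 * c := by rw [← hef]; linarith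
    have hy0 : 0 ≤ y := by positivity
    have hle : (2 * c - m * (1 + e ^ 2) / 2) / √(N - 2 * B * e + D * e ^ 2) ≤ -y := by
      rw [← neg_sub, neg_div, neg_le_neg_iff, hy, ← hef]
      exact div_le_div_of_nonneg_left (by linarith) hR0 hR
    have hP := stdNormal_cdf_neg_mul_sq_le hy0
    have hP0 : 0 ≤ Φ (-y) := cdf_nonneg _ _
    have hmono : Φ ((2 * c - m * (1 + e ^ 2) / 2) / √(N - 2 * B * e + D * e ^ 2)) ≤ Φ (-y) :=
      monotone_cdf _ hle
    have hm2 : m * (1 + f ^ 2) = 4 * c * (1 + 2 * (k * y) * (1 + f)) := by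
      have : y * (√N * (1 + f)) = m * (1 + f ^ 2) / 2 - 2 * c := by
        rw [hy]; field_simp
      rw [← hck] at this
      linarith
    generalize Φ (-y) = P at *
    have hu : 0 ≤ k * y := by positivity
    generalize k * y = u at *
    have h1 : 1 + 2 * u * (1 + f) ≤ (1 + f ^ 2) * (1 + u) ^ 2 := by
      nlinarith [sq_nonneg (u - f), mul_nonneg (sq_nonneg f) hu, sq_nonneg (f * u)]
    have h2 : m * P * (1 + f ^ 2) ≤ 2 * c * (1 + f ^ 2) := by
      calc m * P * (1 + f ^ 2) = 4 * c * P * (1 + 2 * u * (1 + f)) := by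
            linear_combination P * hm2
        _ ≤ 4 * c * P * ((1 + f ^ 2) * (1 + u) ^ 2) := by gcongr
        _ = 2 * c * (1 + f ^ 2) * (P * (2 * (1 + u) ^ 2)) := by ring
        _ ≤ 2 * c * (1 + f ^ 2) * 1 := by gcongr
        _ = _ := by ring
    have h3 := le_of_mul_le_mul_right h2 (by positivity)
    linarith [mul_le_mul_of_nonneg_left hmono hm.le]

/-- A linear form is a centred gaussian under `binormal`. -/
theorem binormal_linear_lt {sx sy ρ : ℝ} (hρ : ρ ^ 2 ≤ 1) (l : ℝ × ℝ) (τ : ℝ)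
    (hQ : 0 < sx ^ 2 * l.1 ^ 2 + 2 * ρ * sx * sy * l.1 * l.2 + sy ^ 2 * l.2 ^ 2) :
    (binormal sx sy ρ).real {p | p.1 * l.1 + p.2 * l.2 < τ} =
      Φ (τ / √(sx ^ 2 * l.1 ^ 2 + 2 * ρ * sx * sy * l.1 * l.2 + sy ^ 2 * l.2 ^ 2)) := by
  set Q := sx ^ 2 * l.1 ^ 2 + 2 * ρ * sx * sy * l.1 * l.2 + sy ^ 2 * l.2 ^ 2 with hQdef
  set A := sx * l.1 + sy * ρ * l.2 with hA
  set B := sy * √(1 - ρ ^ 2) * l.2 with hB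
  have hAB : A ^ 2 + B ^ 2 = Q := by
    rw [hA, hB, mul_pow, mul_pow, Real.sq_sqrt (by linarith)]
    ring
  have hind := indepFun_prod (μ := gaussianReal 0 1) (ν := gaussianReal 0 1)
    (measurable_const_mul A) (measurable_const_mul B)
  have hX : Measure.map (fun ω : ℝ × ℝ => A * ω.1) ((gaussianReal 0 1).prod (gaussianReal 0 1)) =
      gaussianReal (A * 0) (NNReal.mk (A ^ 2) (sq_nonneg A) * 1) := by
    rw [← gaussianReal_map_const_mul]
    conv_rhs => rw [← Measure.fst_prod (μ := gaussianReal 0 1) (ν := gaussianReal 0 1)]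
    exact (Measure.map_map (measurable_const_mul A) measurable_fst).symm
  have hY : Measure.map (fun ω : ℝ × ℝ => B * ω.2) ((gaussianReal 0 1).prod (gaussianReal 0 1)) =
      gaussianReal (B * 0) (NNReal.mk (B ^ 2) (sq_nonneg B) * 1) := by
    rw [← gaussianReal_map_const_mul]
    conv_rhs => rw [← Measure.snd_prod (μ := gaussianReal 0 1) (ν := gaussianReal 0 1)]
    exact (Measure.map_map (measurable_const_mul B) measurable_snd).symm
  have hXY := gaussianReal_add_gaussianReal_of_indepFun hind hX hY
  have hlaw : gaussianReal (A * 0 + B * 0)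
      (NNReal.mk (A ^ 2) (sq_nonneg A) * 1 + NNReal.mk (B ^ 2) (sq_nonneg B) * 1) =
      Measure.map (fun x => √Q * x) (gaussianReal 0 1) := by
    rw [gaussianReal_map_const_mul]
    congr 1
    · simp
    · ext
      simp [Real.sq_sqrt hQ.le, hAB]
  have hsQ := Real.sqrt_pos.2 hQ
  have := nullSingletonClass_gaussianReal (μ := 0) (v := 1) one_ne_zero
  have hset : (fun z : ℝ × ℝ => (sx * z.1, sy * (ρ * z.1 + √(1 - ρ ^ 2) * z.2))) ⁻¹'
      {p | p.1 * l.1 + p.2 * l.2 < τ} =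
      ((fun ω : ℝ × ℝ => A * ω.1) + fun ω : ℝ × ℝ => B * ω.2) ⁻¹' Set.Iio τ := by
    ext z
    simp only [Set.mem_preimage, Set.mem_ofPred_eq, Pi.add_apply, Set.mem_Iio, hA, hB]
    ring_nf
  have hset' : (fun x => √Q * x) ⁻¹' Set.Iio τ = Set.Iio (τ / √Q) := by
    ext x
    simp [lt_div_iff₀ hsQ, mul_comm]
  rw [binormal, map_measureReal_apply (by fun_prop)
    (measurableSet_lt (by fun_prop) measurable_const), hset,
    ← map_measureReal_apply (by fun_prop) measurableSet_Iio, hXY, hlaw,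
    map_measureReal_apply (by fun_prop) measurableSet_Iio, hset', cdf_eq_real]
  exact measureReal_congr Iio_ae_eq_Iic

theorem binormal_quadratic_pos {sx sy ρ : ℝ} (hsx : 0 < sx) (hsy : 0 < sy) (hρ : ρ ^ 2 < 1)
    {l : ℝ × ℝ} (hl : l ≠ 0) :
    0 < sx ^ 2 * l.1 ^ 2 + 2 * ρ * sx * sy * l.1 * l.2 + sy ^ 2 * l.2 ^ 2 := by
  have h : sx ^ 2 * l.1 ^ 2 + 2 * ρ * sx * sy * l.1 * l.2 + sy ^ 2 * l.2 ^ 2 =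
      (sx * l.1 + ρ * (sy * l.2)) ^ 2 + (1 - ρ ^ 2) * (sy * l.2) ^ 2 := by ring
  rw [h]
  have h1 : 0 < 1 - ρ ^ 2 := by linarith
  by_cases h2 : l.2 = 0
  · have h3 : l.1 ≠ 0 := fun h3 => hl (Prod.ext h3 h2)
    have : 0 < (sx * l.1) ^ 2 := by positivity
    simpa [h2] using this
  · positivity

/-- The payoff when Player I deviates from `b` by the displacement `-l`. -/
theorem K_sub_eq {sx sy ρ : ℝ} (hsx : 0 < sx) (hsy : 0 < sy) (hρ : ρ ^ 2 < 1) (b : ℝ × ℝ)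
    {l : ℝ × ℝ} (hl : l ≠ 0) :
    K sx sy ρ (b - l) b = b.1 + b.2 - (l.1 + l.2) *
      Φ ((b.1 * l.1 + b.2 * l.2 - (l.1 ^ 2 + l.2 ^ 2) / 2) /
        √(sx ^ 2 * l.1 ^ 2 + 2 * ρ * sx * sy * l.1 * l.2 + sy ^ 2 * l.2 ^ 2)) := by
  have hQ := binormal_quadratic_pos hsx hsy hρ hl
  have h1 : closerTo (b - l) b =
      {p | p.1 * l.1 + p.2 * l.2 < b.1 * l.1 + b.2 * l.2 - (l.1 ^ 2 + l.2 ^ 2) / 2} := by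
    ext p
    simp only [closerTo, Set.mem_ofPred_eq, Prod.fst_sub, Prod.snd_sub]
    constructor <;> intro h <;> linarith
  have h2 : closerTo b (b - l) =
      {p | p.1 * (-l).1 + p.2 * (-l).2 < -(b.1 * l.1 + b.2 * l.2 - (l.1 ^ 2 + l.2 ^ 2) / 2)} := by
    ext p
    simp only [closerTo, Set.mem_ofPred_eq, Prod.fst_sub, Prod.snd_sub, Prod.fst_neg, Prod.snd_neg]
    constructor <;> intro h <;> linarith
  have hQ' : sx ^ 2 * (-l).1 ^ 2 + 2 * ρ * sx * sy * (-l).1 * (-l).2 + sy ^ 2 * (-l).2 ^ 2 =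
      sx ^ 2 * l.1 ^ 2 + 2 * ρ * sx * sy * l.1 * l.2 + sy ^ 2 * l.2 ^ 2 := by
    simp only [Prod.fst_neg, Prod.snd_neg]
    ring
  rw [K, if_neg (by simpa using hl), ← measureReal_def, ← measureReal_def, h1, h2,
    binormal_linear_lt hρ.le l _ hQ, binormal_linear_lt hρ.le (-l) _ (hQ' ▸ hQ), hQ', neg_div,
    stdNormal_cdf_neg]
  simp only [Prod.fst_sub, Prod.snd_sub]
  ring

/-- The payoff in terms of the coordinate sum `m` of the displacement and its slope `e`. -/
theorem K_diagonal_sub_eq {sx sy ρ : ℝ} (hsx : 0 < sx) (hsy : 0 < sy) (hρ : ρ ^ 2 < 1)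
    (c e : ℝ) {m : ℝ} (hm : 0 < m) :
    K sx sy ρ (c - m * (1 + e) / 2, c - m * (1 - e) / 2) (c, c) = 2 * c - m *
      Φ ((2 * c - m * (1 + e ^ 2) / 2) / √(sx ^ 2 + 2 * ρ * sx * sy + sy ^ 2 -
        2 * (sy ^ 2 - sx ^ 2) * e + (sx ^ 2 + sy ^ 2 - 2 * ρ * sx * sy) * e ^ 2)) := by
  set R := sx ^ 2 + 2 * ρ * sx * sy + sy ^ 2 -
        2 * (sy ^ 2 - sx ^ 2) * e + (sx ^ 2 + sy ^ 2 - 2 * ρ * sx * sy) * e ^ 2 with hR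
  have hl : (m * (1 + e) / 2, m * (1 - e) / 2) ≠ (0 : ℝ × ℝ) := by
    intro h
    have h1 := congrArg Prod.fst h
    have h2 := congrArg Prod.snd h
    simp only [Prod.fst_zero, Prod.snd_zero] at h1 h2
    linarith
  have hQ : sx ^ 2 * (m * (1 + e) / 2) ^ 2 +
      2 * ρ * sx * sy * (m * (1 + e) / 2) * (m * (1 - e) / 2) +
      sy ^ 2 * (m * (1 - e) / 2) ^ 2 = (m / 2) ^ 2 * R := by
    rw [hR]
    ring
  have h := K_sub_eq hsx hsy hρ (c, c) hl
  simp only [Prod.mk_sub_mk] at h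
  rw [h, hQ, Real.sqrt_mul (sq_nonneg _), Real.sqrt_sq (by positivity),
    ← mul_div_mul_left (2 * c - m * (1 + e ^ 2) / 2) (√R) (by positivity : m / 2 ≠ 0)]
  ring_nf

theorem exists_polar_of_slope {t₀ x y : ℝ} (hx : 0 < x) (h₀ : t₀ ≤ y / x) (h₁ : y / x ≤ 1) :
    ∃ r : ℝ, 0 ≤ r ∧ ∃ θ ∈ Set.Icc (π + arctan t₀) (5 * π / 4),
      r * cos θ = -x ∧ r * sin θ = -y := by
  refine ⟨x * √(1 + (y / x) ^ 2), by positivity, π + arctan (y / x), ⟨?_, ?_⟩, ?_, ?_⟩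
  · gcongr
  · have := arctan_strictMono.monotone h₁
    rw [arctan_one] at this
    linarith
  · rw [add_comm π, cos_add_pi, cos_arctan]
    field_simp
  · rw [add_comm π, sin_add_pi, sin_arctan]
    field_simp

theorem min_in_cone (sx sy ρ : ℝ) (hsx : 0 < sx) (hsy : 0 < sy)
    (hρ : ρ ∈ Set.Ioo (0 : ℝ) 1) (hσ : sx < sy) :
    let c := cstar sx sy ρ
    let α' := sx ^ 2 - ρ * sx * sy
    let β' := sy ^ 2 - ρ * sx * sy
    ∀ a : ℝ × ℝ, ∃ r : ℝ, 0 ≤ r ∧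
      ∃ θ ∈ Set.Icc (Real.pi + Real.arctan (α' / β')) (5 * Real.pi / 4),
        K sx sy ρ ((c + r * Real.cos θ, c + r * Real.sin θ) : ℝ × ℝ) ((c, c) : ℝ × ℝ) ≤
          K sx sy ρ a ((c, c) : ℝ × ℝ) := by
  intro c α' β' a
  obtain ⟨hρ0, hρ1⟩ := hρ
  have hρ2 : ρ ^ 2 < 1 := by nlinarith
  have hxy : 0 < sx * sy := by positivity
  have hρxy : ρ * sx * sy < sx * sy := by nlinarith
  have hρxy0 : 0 < ρ * sx * sy := by positivity
  have hβ : 0 < β' := by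
    change 0 < sy ^ 2 - ρ * sx * sy
    nlinarith
  have hD : 0 < sx ^ 2 + sy ^ 2 - 2 * ρ * sx * sy := by nlinarith [sq_nonneg (sx - sy)]
  have hαβ : α' + β' = sx ^ 2 + sy ^ 2 - 2 * ρ * sx * sy := by
    simp only [α', β']
    ring
  have hB : 0 < sy ^ 2 - sx ^ 2 := by nlinarith
  have hβα : β' - α' = sy ^ 2 - sx ^ 2 := by
    simp only [α', β']
    ring
  by_cases hm : 0 < 2 * c - (a.1 + a.2)
  · obtain ⟨m, e, hm0, rfl⟩ : ∃ m e : ℝ, 0 < m ∧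
        a = (c - m * (1 + e) / 2, c - m * (1 - e) / 2) := by
      have h := mul_div_cancel₀ (a.2 - a.1) hm.ne'
      exact ⟨_, (a.2 - a.1) / (2 * c - (a.1 + a.2)), hm,
        Prod.ext (by dsimp only; linarith) (by dsimp only; linarith)⟩
    obtain ⟨m', hm', e', ⟨he0, he1⟩, hle⟩ := exists_slope_mem_Icc
      (N := sx ^ 2 + 2 * ρ * sx * sy + sy ^ 2) (c := c) (by positivity) hB hD (by linarith)
      (by nlinarith [mul_pos (mul_pos hxy hxy) (sub_pos.2 hρ2)]) rfl m e hm0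
    rw [le_div_iff₀ hD, ← hαβ, ← hβα] at he1
    have hslope : m' * (1 - e') / 2 / (m' * (1 + e') / 2) = (1 - e') / (1 + e') := by
      field_simp
    obtain ⟨r, hr, θ, hθ, hcos, hsin⟩ :=
      exists_polar_of_slope (t₀ := α' / β') (x := m' * (1 + e') / 2) (y := m' * (1 - e') / 2)
        (by positivity)
        (by rw [hslope, div_le_div_iff₀ hβ (by positivity)]; linarith)
        (by rw [hslope, div_le_one (by positivity)]; linarith)
    refine ⟨r, hr, θ, hθ, ?_⟩
    rw [hcos, hsin, ← sub_eq_add_neg, ← sub_eq_add_neg, K_diagonal_sub_eq hsx hsy hρ2 c e' hm',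
      K_diagonal_sub_eq hsx hsy hρ2 c e hm0]
    linarith
  · refine ⟨0, le_rfl, 5 * π / 4, ⟨?_, le_rfl⟩, ?_⟩
    · have : α' / β' ≤ 1 := by
        rw [div_le_one hβ]
        linarith
      have := arctan_strictMono.monotone this
      rw [arctan_one] at this
      linarith
    · have hK : K sx sy ρ (c, c) (c, c) = c + c := by simp [K]
      simp only [zero_mul, add_zero, hK]
      by_cases hl : (c, c) - a = 0
      · rw [← sub_eq_zero.1 hl, hK]
      · have h := K_sub_eq hsx hsy hρ2 (c, c) hl
        rw [sub_sub_cancel] at h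
        rw [h]
        simp only [Prod.fst_sub, Prod.snd_sub]
        have : ∀ P : ℝ, 0 ≤ P → c + c ≤ c + c - (c - a.1 + (c - a.2)) * P := fun P hP => by
          nlinarith
        exact this _ (cdf_nonneg _ _)
end

section
/- Assume ρ ∈ (0,1) and σx < σy. For θ ∈ ℝ let σθ² = σx²·cos²θ + 2ρσxσy·cos θ·sin θ + σy²·sin²θ. Let T = (σy² − σx²)/(2ρσxσy) − √(((σy² − σx²)/(2ρσxσy))² + 1) and θ_M = π + arctan T. Then θ_M > 3π/4, and θ_M minimizes the directional variance: σ_{θ_M}² ≤ σθ² for every θ ∈ ℝ. -/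
open Real

/-- If `(1, T)` is an eigenvector of the quadratic form `a x² + b x y + c y²`, the form minus
its eigenvalue is a multiple of the square of the linear form vanishing on `(1, T)`. -/
theorem quadratic_form_sub_eigenvalue {a b c T : ℝ} (hT : T ≠ 0)
    (h : b * (T ^ 2 - 1) = 2 * (c - a) * T) {x y : ℝ} (hxy : x ^ 2 + y ^ 2 = 1) :
    a * x ^ 2 + b * x * y + c * y ^ 2 = a + b * T / 2 + b / (2 * -T) * (T * x - y) ^ 2 := by
  have hc : c = a + b * (T ^ 2 - 1) / (2 * T) := by
    field_simp
    linarith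
  have hx : x ^ 2 = 1 - y ^ 2 := by linarith
  rw [hc]
  field_simp
  ring_nf
  rw [hx]
  ring

theorem sin_arctan_eq_mul_cos_arctan (x : ℝ) : sin (arctan x) = x * cos (arctan x) := by
  rw [← tan_mul_cos (cos_arctan_pos x).ne', tan_arctan]

theorem minor_axis_minimizes_variance (sx sy ρ : ℝ) (hsx : 0 < sx) (hsy : 0 < sy)
    (hρ : ρ ∈ Set.Ioo (0 : ℝ) 1) (hσ : sx < sy) :
    let σsq : ℝ → ℝ := fun θ =>
      sx ^ 2 * Real.cos θ ^ 2 + 2 * ρ * sx * sy * Real.cos θ * Real.sin θ +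
        sy ^ 2 * Real.sin θ ^ 2
    let T := (sy ^ 2 - sx ^ 2) / (2 * ρ * sx * sy) -
      Real.sqrt (((sy ^ 2 - sx ^ 2) / (2 * ρ * sx * sy)) ^ 2 + 1)
    let θM := Real.pi + Real.arctan T
    θM > 3 * Real.pi / 4 ∧ ∀ θ : ℝ, σsq θM ≤ σsq θ := by
  intro σsq T θM
  have hb : 0 < 2 * ρ * sx * sy := by
    have := hρ.1
    positivity
  have hr : 0 < (sy ^ 2 - sx ^ 2) / (2 * ρ * sx * sy) := div_pos (by nlinarith) hb
  have hbr : 2 * ρ * sx * sy * ((sy ^ 2 - sx ^ 2) / (2 * ρ * sx * sy)) = sy ^ 2 - sx ^ 2 :=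
    mul_div_cancel₀ _ hb.ne'
  have hTdef : T = (sy ^ 2 - sx ^ 2) / (2 * ρ * sx * sy) -
      √(((sy ^ 2 - sx ^ 2) / (2 * ρ * sx * sy)) ^ 2 + 1) := rfl
  generalize (sy ^ 2 - sx ^ 2) / (2 * ρ * sx * sy) = r at hr hbr hTdef
  have hsq : √(r ^ 2 + 1) ^ 2 = r ^ 2 + 1 := sq_sqrt (by positivity)
  have hT0 : T < 0 := by
    have : r < √(r ^ 2 + 1) := lt_sqrt_of_sq_lt (by linarith)
    linarith
  have hT1 : -1 < T := by
    have : √(r ^ 2 + 1) < r + 1 := (sqrt_lt' (by linarith)).2 (by nlinarith)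
    linarith
  have hTr : T ^ 2 - 1 = 2 * r * T := by
    rw [hTdef]
    linear_combination hsq
  have hσsq (θ : ℝ) : σsq θ = sx ^ 2 + 2 * ρ * sx * sy * T / 2 +
      2 * ρ * sx * sy / (2 * -T) * (T * cos θ - sin θ) ^ 2 :=
    quadratic_form_sub_eigenvalue hT0.ne (by rw [hTr, ← hbr]; ring) (cos_sq_add_sin_sq θ)
  refine ⟨?_, fun θ => ?_⟩
  · have := arctan_strictMono hT1
    rw [arctan_neg, arctan_one] at this
    change 3 * π / 4 < π + arctan T
    linarith
  · have hM : T * cos θM - sin θM = 0 := by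
      simp only [θM, add_comm π, cos_add_pi, sin_add_pi, sin_arctan_eq_mul_cos_arctan]
      ring
    rw [hσsq, hσsq, hM]
    have : 0 ≤ 2 * ρ * sx * sy / (2 * -T) * (T * cos θ - sin θ) ^ 2 :=
      mul_nonneg (div_nonneg hb.le (by linarith)) (sq_nonneg _)
    linarith
end

section
/- Assume ρ ∈ (0,1) and 0 < σx < σy. Let α' = σx² − ρσxσy and β' = σy² − ρσxσy. Then (σy² − σx²)/(2ρσxσy) − √(((σy² − σx²)/(2ρσxσy))² + 1) < α'/β'. Equivalently, with T denoting the left-hand side and θ_M = π + arctan T, one has θ_M < π + arctan(α'/β'). -/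
open Real

/-- For a positive definite matrix `!![a, c; c, b]` with `a < b` and `0 < c < b`, the slope of the
minor axis is less than `(a - c) / (b - c)`. -/
lemma sub_sqrt_lt_div_of_sq_lt_mul {a b c : ℝ} (hc : 0 < c) (hab : a < b) (hcb : c < b)
    (hdet : c ^ 2 < a * b) :
    (b - a) / (2 * c) - √(((b - a) / (2 * c)) ^ 2 + 1) < (a - c) / (b - c) := by
  have hbc : 0 < b - c := sub_pos.2 hcb
  have key : ((b - a) / (2 * c)) ^ 2 + 1 - ((b - a) / (2 * c) - (a - c) / (b - c)) ^ 2 =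
      (b - a) * (a * b - c ^ 2) / (c * (b - c) ^ 2) := by
    field_simp
    ring
  have hpos : 0 < (b - a) * (a * b - c ^ 2) / (c * (b - c) ^ 2) :=
    div_pos (mul_pos (sub_pos.2 hab) (sub_pos.2 hdet)) (by positivity)
  have := Real.lt_sqrt_of_sq_lt (sub_pos.1 (key ▸ hpos))
  linarith

theorem minor_axis_angle_lt (sx sy ρ : ℝ) (hsx : 0 < sx) (hsy : 0 < sy)
    (hρ : ρ ∈ Set.Ioo (0 : ℝ) 1) (hσ : sx < sy) :
    let α' := sx ^ 2 - ρ * sx * sy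
    let β' := sy ^ 2 - ρ * sx * sy
    let T := (sy ^ 2 - sx ^ 2) / (2 * ρ * sx * sy) -
      Real.sqrt (((sy ^ 2 - sx ^ 2) / (2 * ρ * sx * sy)) ^ 2 + 1)
    T < α' / β' ∧
      Real.pi + Real.arctan T < Real.pi + Real.arctan (α' / β') := by
  intro α' β' T
  obtain ⟨hρ0, hρ1⟩ := hρ
  have hxy : 0 < sx * sy := mul_pos hsx hsy
  have hc : 0 < ρ * sx * sy := by positivity
  have hc_lt : ρ * sx * sy < sx * sy := by nlinarith
  have hlt : T < α' / β' := by
    have h := sub_sqrt_lt_div_of_sq_lt_mul (a := sx ^ 2) (b := sy ^ 2) hc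
      (by gcongr) (by nlinarith) (by rw [← mul_pow]; gcongr)
    rwa [show 2 * (ρ * sx * sy) = 2 * ρ * sx * sy by ring] at h
  exact ⟨hlt, by gcongr⟩
end

section
/- Assume ρ ∈ (0,1) and σx < σy. Let T = (σy² − σx²)/(2ρσxσy) − √(((σy² − σx²)/(2ρσxσy))² + 1) and θ_M = π + arctan T. Let r > 0 and θ ∈ [θ_M, 5π/4], and set a = (c + r·cos θ, c + r·sin θ) = (x1, y1). If x1² + y1² > 2c², then K(a, b*) > 0. -/
open MeasureTheory ProbabilityTheory Real

/-- The standard gaussian upper tail is differentiable, with derivative minus the density. -/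
lemma hasDerivAt_gaussianReal_real_Ioi (t : ℝ) :
    HasDerivAt (fun x => (gaussianReal 0 1).real (Set.Ioi x))
      (-((√(2 * π))⁻¹ * exp (-t ^ 2 / 2))) t := by
  have hpdf (x : ℝ) : gaussianPDFReal 0 1 x = (√(2 * π))⁻¹ * exp (-x ^ 2 / 2) := by
    simp [gaussianPDFReal]
  have hint := integrable_gaussianPDFReal 0 1
  have hcont : Continuous (gaussianPDFReal 0 1) := by
    have : gaussianPDFReal 0 1 = fun x => (√(2 * π))⁻¹ * exp (-x ^ 2 / 2) := funext hpdf
    rw [this]; fun_prop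
  have key (x : ℝ) : (gaussianReal 0 1).real (Set.Ioi x)
      = (∫ y in Set.Ioi (0 : ℝ), gaussianPDFReal 0 1 y)
        - ∫ y in (0 : ℝ)..x, gaussianPDFReal 0 1 y := by
    rw [measureReal_def, gaussianReal_apply_eq_integral _ one_ne_zero,
      ENNReal.toReal_ofReal (integral_nonneg fun y => gaussianPDFReal_nonneg _ _ _),
      eq_sub_iff_add_eq, add_comm]
    exact intervalIntegral.integral_interval_add_Ioi hint.integrableOn hint.integrableOn
  rw [funext key, ← hpdf]
  exact (intervalIntegral.integral_hasDerivAt_right (hcont.intervalIntegrable _ _)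
    (hcont.stronglyMeasurableAtFilter _ _) hcont.continuousAt).const_sub _

lemma gaussianReal_real_Ioi_neg (t : ℝ) :
    (gaussianReal 0 1).real (Set.Ioi (-t)) = 1 - (gaussianReal 0 1).real (Set.Ioi t) := by
  have h : (gaussianReal 0 1).map (fun x : ℝ => -x) = gaussianReal 0 1 := by
    rw [gaussianReal_map_neg, neg_zero]
  have h1 : (fun x : ℝ => -x) ⁻¹' Set.Ioi (-t) = Set.Iio t := by ext; simp
  have := nullSingletonClass_gaussianReal (μ := 0) (one_ne_zero (α := NNReal))
  rw [← probReal_compl_eq_one_sub measurableSet_Ioi, Set.compl_Ioi,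
    ← measureReal_congr (Iio_ae_eq_Iic (μ := gaussianReal 0 1) (a := t))]
  conv_lhs => rw [← h, map_measureReal_apply measurable_neg measurableSet_Ioi, h1]

lemma gaussianReal_real_Ioi_zero : (gaussianReal 0 1).real (Set.Ioi 0) = 1 / 2 := by
  have := gaussianReal_real_Ioi_neg 0
  rw [neg_zero] at this
  linarith

lemma tendsto_gaussianReal_real_Ioi_atTop :
    Filter.Tendsto (fun x => (gaussianReal 0 1).real (Set.Ioi x)) Filter.atTop (nhds 0) := by
  have h := (tendsto_cdf_atTop (gaussianReal 0 1)).const_sub 1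
  rw [sub_self] at h
  refine h.congr fun x => ?_
  rw [cdf_eq_real, ← Set.compl_Iic, probReal_compl_eq_one_sub measurableSet_Iic]

/-- The graph of `x ↦ exp (x ^ 2 / 4)` is star-convex with respect to the point `(0, 1)`. -/
lemma exp_sq_div_four_lt {x y : ℝ} (hx : 0 < x) (hxy : x < y) :
    exp (x ^ 2 / 4) < 1 + x / y * (exp (y ^ 2 / 4) - 1) := by
  have hy := hx.trans hxy
  have hl0 : 0 < x / y := by positivity
  have hl1 : x / y < 1 := (div_lt_one hy).2 hxy
  have hc := strictConvexOn_exp.2 (Set.mem_univ 0) (Set.mem_univ (y ^ 2 / 4))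
    (by positivity) (sub_pos.2 hl1) hl0 (by ring)
  simp only [smul_eq_mul, mul_zero, zero_add, exp_zero, mul_one] at hc
  have : x ^ 2 / 4 ≤ x / y * (y ^ 2 / 4) := by
    have : x / y * (y ^ 2 / 4) = x * y / 4 := by field_simp
    nlinarith
  linarith [exp_le_exp.2 this]

/-- An upper bound for the standard gaussian tail, sharp to first order at `0`. -/
lemma gaussianReal_real_Ioi_lt {t : ℝ} (ht : 0 < t) :
    (gaussianReal 0 1).real (Set.Ioi t) < (1 + 2 * (√(2 * π))⁻¹ * t)⁻¹ / 2 := by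
  set κ := (√(2 * π))⁻¹ with hκ
  have hκ0 : 0 < κ := by positivity
  set F : ℝ → ℝ := fun x => (1 + 2 * κ * x)⁻¹ / 2 - (gaussianReal 0 1).real (Set.Ioi x) with hF
  have hder (x : ℝ) (hx : 0 ≤ x) :
      HasDerivAt F (κ * (exp (-x ^ 2 / 2) - ((1 + 2 * κ * x) ^ 2)⁻¹)) x := by
    have hne : 1 + 2 * κ * x ≠ 0 := by positivity
    have h1 : HasDerivAt (fun x => 1 + 2 * κ * x) (2 * κ) x := by
      simpa using ((hasDerivAt_id x).const_mul (2 * κ)).const_add 1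
    refine (((h1.inv hne).div_const 2).sub (hasDerivAt_gaussianReal_real_Ioi x)).congr_deriv ?_
    rw [← hκ]
    field_simp
    ring
  have hcont {s : Set ℝ} (hs : s ⊆ Set.Ici 0) : ContinuousOn F s :=
    fun x hx => (hder x (hs hx)).continuousAt.continuousWithinAt
  have hexp (x : ℝ) : exp (-x ^ 2 / 2) = (exp (x ^ 2 / 4) ^ 2)⁻¹ := by
    rw [← exp_nat_mul, ← exp_neg]; congr 1; push_cast; ring
  suffices 0 < F t by simpa [hF] using this
  rcases le_or_gt (exp (t ^ 2 / 4)) (1 + 2 * κ * t) with h | h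
  · have hmono : StrictMonoOn F (Set.Icc 0 t) := by
      refine strictMonoOn_of_deriv_pos (convex_Icc 0 t) (hcont fun x hx => hx.1) fun x hx => ?_
      rw [interior_Icc] at hx
      rw [(hder x hx.1.le).deriv, hexp]
      refine mul_pos hκ0 (sub_pos.2 ?_)
      have h1 := exp_sq_div_four_lt hx.1 hx.2
      have hx0 := hx.1
      have h2 : x / t * (exp (t ^ 2 / 4) - 1) ≤ x / t * (2 * κ * t) := by
        gcongr; linarith
      have h3 : x / t * (2 * κ * t) = 2 * κ * x := by field_simp
      gcongr
      linarith
    have := hmono ⟨le_rfl, ht.le⟩ ⟨ht.le, le_rfl⟩ ht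
    simpa [hF, gaussianReal_real_Ioi_zero] using this
  · have hanti : StrictAntiOn F (Set.Ici t) := by
      refine strictAntiOn_of_deriv_neg (convex_Ici t)
        (hcont fun x hx => ht.le.trans hx) fun x hx => ?_
      rw [interior_Ici] at hx
      have hx0 := ht.trans hx
      rw [(hder x hx0.le).deriv, hexp]
      refine mul_neg_of_pos_of_neg hκ0 (sub_neg.2 ?_)
      have h1 := exp_sq_div_four_lt ht hx
      have h3 : t / x * (2 * κ * x) = 2 * κ * t := by field_simp
      have h2 : t / x * (2 * κ * x) < t / x * (exp (x ^ 2 / 4) - 1) := by linarith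
      have h4 := lt_of_mul_lt_mul_left h2 (by positivity)
      gcongr
      linarith
    have hlim : Filter.Tendsto F Filter.atTop (nhds 0) := by
      have h1 : Filter.Tendsto (fun x => 1 + 2 * κ * x) Filter.atTop Filter.atTop :=
        Filter.tendsto_atTop_add_const_left _ _
          (Filter.tendsto_id.const_mul_atTop (by positivity))
      simpa using (h1.inv_tendsto_atTop.div_const 2).sub tendsto_gaussianReal_real_Ioi_atTop
    have hle : 0 ≤ F (t + 1) := by
      refine le_of_tendsto hlim ?_
      filter_upwards [Filter.eventually_ge_atTop (t + 1)] with x hx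
      exact hanti.antitoneOn (by simp) (Set.mem_Ici.2 (by linarith)) hx
    exact hle.trans_lt (hanti Set.self_mem_Ici (by simp) (by linarith))

lemma map_linear_gaussianReal_prod {α β w : ℝ} (hw : w ^ 2 = α ^ 2 + β ^ 2) :
    ((gaussianReal 0 1).prod (gaussianReal 0 1)).map (fun z : ℝ × ℝ => α * z.1 + β * z.2)
      = (gaussianReal 0 1).map (w * ·) := by
  have : (fun z : ℝ × ℝ => α * z.1 + β * z.2)
      = (fun z : ℝ × ℝ => z.1 + z.2) ∘ Prod.map (α * ·) (β * ·) := rfl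
  rw [this, ← Measure.map_map (by fun_prop) (by fun_prop),
    ← Measure.map_prod_map _ _ (by fun_prop) (by fun_prop)]
  change Measure.conv _ _ = _
  simp only [gaussianReal_map_const_mul, gaussianReal_conv_gaussianReal]
  congr 1
  · simp
  · ext; simp [hw]

/-- The variance of `p * X + q * Y`, where `(X, Y)` has law `binormal sx sy ρ`. -/
noncomputable def linVar (sx sy ρ p q : ℝ) : ℝ :=
  sx ^ 2 * p ^ 2 + 2 * ρ * sx * sy * p * q + sy ^ 2 * q ^ 2

lemma linVar_pos {sx sy ρ p q : ℝ} (hsx : 0 < sx) (hsy : 0 < sy) (hρ : ρ ∈ Set.Ioo (0 : ℝ) 1)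
    (hpq : p ^ 2 + q ^ 2 = 1) : 0 < linVar sx sy ρ p q := by
  have hρ1 : 0 < 1 - ρ ^ 2 := by nlinarith [hρ.1, hρ.2]
  have e : linVar sx sy ρ p q = (sx * p + sy * ρ * q) ^ 2 + (1 - ρ ^ 2) * (sy * q) ^ 2 := by
    unfold linVar; ring
  rw [e]
  rcases eq_or_ne q 0 with rfl | hq
  · have hp : p ≠ 0 := by rintro rfl; norm_num at hpq
    have : sx * p + sy * ρ * 0 ≠ 0 := by simp [hsx.ne', hp]
    positivity
  · positivity

lemma binormal_real_halfPlane {sx sy ρ p q : ℝ} (hv : 0 < linVar sx sy ρ p q)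
    (hρ : ρ ∈ Set.Ioo (0 : ℝ) 1) (m : ℝ) :
    (binormal sx sy ρ).real {z | m < p * z.1 + q * z.2}
      = (gaussianReal 0 1).real (Set.Ioi (m / √(linVar sx sy ρ p q))) := by
  have hρ1 : 0 ≤ 1 - ρ ^ 2 := by nlinarith [hρ.1, hρ.2]
  set w := √(linVar sx sy ρ p q) with hw
  have hw0 : 0 < w := Real.sqrt_pos.2 hv
  have hmap := map_linear_gaussianReal_prod (α := sx * p + sy * ρ * q)
    (β := sy * √(1 - ρ ^ 2) * q) (w := w) (by
      rw [hw, Real.sq_sqrt hv.le, mul_pow, mul_pow, Real.sq_sqrt hρ1]; unfold linVar; ring)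
  have hset : MeasurableSet {z : ℝ × ℝ | m < p * z.1 + q * z.2} :=
    measurableSet_lt (by fun_prop) (by fun_prop)
  rw [binormal, map_measureReal_apply (by fun_prop) hset]
  have h1 := congrArg (fun μ => μ.real (Set.Ioi m)) hmap
  beta_reduce at h1
  rw [map_measureReal_apply (by fun_prop) measurableSet_Ioi,
    map_measureReal_apply (by fun_prop) measurableSet_Ioi] at h1
  convert h1 using 2
  · ext z
    simp only [Set.mem_preimage, Set.mem_ofPred_eq, Set.mem_Ioi]
    ring_nf
  · ext x
    simp only [Set.mem_preimage, Set.mem_Ioi, div_lt_iff₀ hw0, mul_comm]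

lemma closerTo_shift {b p q r : ℝ} (hr : 0 < r) (hpq : p ^ 2 + q ^ 2 = 1) :
    closerTo (b + r * p, b + r * q) (b, b)
      = {z | b * (p + q) + r / 2 < p * z.1 + q * z.2} := by
  ext z
  simp only [closerTo, Set.mem_ofPred_eq]
  have e : (z.1 - b) ^ 2 + (z.2 - b) ^ 2 - ((z.1 - (b + r * p)) ^ 2 + (z.2 - (b + r * q)) ^ 2)
      = 2 * r * (p * z.1 + q * z.2 - (b * (p + q) + r / 2)) := by
    linear_combination (-r ^ 2) * hpq
  rw [← sub_pos, e, mul_pos_iff_of_pos_left (by positivity), sub_pos]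

lemma closerTo_shift_swap {b p q r : ℝ} (hr : 0 < r) (hpq : p ^ 2 + q ^ 2 = 1) :
    closerTo (b, b) (b + r * p, b + r * q)
      = {z | -(b * (p + q) + r / 2) < -p * z.1 + -q * z.2} := by
  ext z
  simp only [closerTo, Set.mem_ofPred_eq]
  have e : (z.1 - (b + r * p)) ^ 2 + (z.2 - (b + r * q)) ^ 2 - ((z.1 - b) ^ 2 + (z.2 - b) ^ 2)
      = 2 * r * (-p * z.1 + -q * z.2 - -(b * (p + q) + r / 2)) := by
    linear_combination (r ^ 2) * hpq
  rw [← sub_pos, e, mul_pos_iff_of_pos_left (by positivity), sub_pos]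

lemma K_shift {sx sy ρ b p q r : ℝ} (hsx : 0 < sx) (hsy : 0 < sy) (hρ : ρ ∈ Set.Ioo (0 : ℝ) 1)
    (hr : 0 < r) (hpq : p ^ 2 + q ^ 2 = 1) :
    K sx sy ρ (b + r * p, b + r * q) (b, b) = 2 * b + r * (p + q) *
      (gaussianReal 0 1).real (Set.Ioi ((b * (p + q) + r / 2) / √(linVar sx sy ρ p q))) := by
  have hne : ((b + r * p, b + r * q) : ℝ × ℝ) ≠ (b, b) := by
    intro h
    simp only [Prod.mk.injEq, add_eq_left, mul_eq_zero, hr.ne', false_or] at h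
    norm_num [h.1, h.2] at hpq
  have hv := linVar_pos hsx hsy hρ hpq
  have hneg : linVar sx sy ρ (-p) (-q) = linVar sx sy ρ p q := by unfold linVar; ring
  rw [K, if_neg hne, ← measureReal_def, ← measureReal_def, closerTo_shift hr hpq,
    closerTo_shift_swap hr hpq, binormal_real_halfPlane hv hρ,
    binormal_real_halfPlane (hneg ▸ hv) hρ, hneg, neg_div, gaussianReal_real_Ioi_neg]
  ring

lemma linVar_mul_sq_le {sx sy ρ p q : ℝ} (hsx : 0 < sx) (hsy : 0 < sy) (hρ : 0 < ρ)
    (hσ : sx < sy) (hpq : p ^ 2 + q ^ 2 = 1) (h : q ^ 2 ≤ p ^ 2) :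
    linVar sx sy ρ p q * (p + q) ^ 2 ≤ sx ^ 2 + 2 * ρ * sx * sy + sy ^ 2 := by
  have hW : 0 < sx ^ 2 + 2 * ρ * sx * sy + sy ^ 2 := by positivity
  have h1 : 2 * linVar sx sy ρ p q ≤ sx ^ 2 + 2 * ρ * sx * sy + sy ^ 2 := by
    have e : (sx ^ 2 + 2 * ρ * sx * sy + sy ^ 2) * (p ^ 2 + q ^ 2) - 2 * linVar sx sy ρ p q
        = (sy ^ 2 - sx ^ 2) * (p ^ 2 - q ^ 2) + 2 * ρ * sx * sy * (p - q) ^ 2 := by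
      unfold linVar; ring
    rw [hpq, mul_one] at e
    have : 0 ≤ (sy ^ 2 - sx ^ 2) * (p ^ 2 - q ^ 2) :=
      mul_nonneg (by nlinarith) (by linarith)
    have : 0 ≤ 2 * ρ * sx * sy * (p - q) ^ 2 := by positivity
    linarith
  have h2 : (p + q) ^ 2 ≤ 2 := by nlinarith [sq_nonneg (p - q)]
  nlinarith [mul_le_mul_of_nonneg_right h1 (sq_nonneg (p + q))]

lemma K_shift_pos {sx sy ρ p q r : ℝ} (hsx : 0 < sx) (hsy : 0 < sy)
    (hρ : ρ ∈ Set.Ioo (0 : ℝ) 1) (hσ : sx < sy) (hr : 0 < r) (hpq : p ^ 2 + q ^ 2 = 1)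
    (hle : q ^ 2 ≤ p ^ 2) (hm : 0 < cstar sx sy ρ * (p + q) + r / 2) :
    0 < K sx sy ρ (cstar sx sy ρ + r * p, cstar sx sy ρ + r * q)
      (cstar sx sy ρ, cstar sx sy ρ) := by
  have hρ0 := hρ.1
  have hv := linVar_pos hsx hsy hρ hpq
  have hvle := linVar_mul_sq_le hsx hsy hρ0 hσ hpq hle
  have hs2 : (p + q) ^ 2 ≤ 2 := by nlinarith [sq_nonneg (p - q)]
  rw [K_shift hsx hsy hρ hr hpq]
  set c := cstar sx sy ρ with hc
  set v := linVar sx sy ρ p q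
  set W := sx ^ 2 + 2 * ρ * sx * sy + sy ^ 2 with hW
  have hW0 : 0 < W := by positivity
  have hcW : c = √(2 * π) * √W / 4 := by
    rw [hc, cstar, Real.sqrt_mul (by positivity)]
  have hc0 : 0 < c := by rw [hcW]; positivity
  have hw0 : 0 < √v := Real.sqrt_pos.2 hv
  set m := c * (p + q) + r / 2 with hmdef
  set t := m / √v with ht
  have ht0 : 0 < t := by positivity
  have hmt : m = √v * t := by rw [ht]; field_simp
  have htail := gaussianReal_real_Ioi_lt ht0
  set Q := (gaussianReal 0 1).real (Set.Ioi t)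
  have hQ0 : 0 ≤ Q := measureReal_nonneg
  rcases le_or_gt 0 (p + q) with hs | hs
  · positivity
  set κ := (√(2 * π))⁻¹ with hκ
  have hκ0 : 0 < κ := by positivity
  have hcκ : 4 * c * κ = √W := by rw [hcW, hκ]; field_simp
  have hden : 0 < 1 + 2 * κ * t := by positivity
  have hQlt : 2 * Q * (1 + 2 * κ * t) < 1 := by
    have : Q * (1 + 2 * κ * t) < (1 + 2 * κ * t)⁻¹ / 2 * (1 + 2 * κ * t) := by gcongr
    rw [div_mul_eq_mul_div, inv_mul_cancel₀ hden.ne'] at this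
    linarith
  have hws : √v * -(p + q) ≤ √W := by
    apply Real.le_sqrt_of_sq_le
    rw [mul_pow, Real.sq_sqrt hv.le, neg_sq]
    exact hvle
  have hbound : r * -(p + q) ≤ 4 * c * (1 + 2 * κ * t) := by
    have e : r * -(p + q) = 2 * (√v * -(p + q)) * t + 2 * c * (p + q) ^ 2 := by
      linear_combination 2 * (p + q) * (hmdef - hmt)
    have h1 := mul_le_mul_of_nonneg_right hws ht0.le
    have h2 := mul_le_mul_of_nonneg_left hs2 hc0.le
    rw [← hcκ] at h1
    nlinarith
  have h3 : r * -(p + q) * Q ≤ 4 * c * (1 + 2 * κ * t) * Q := by gcongr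
  have h4 : 2 * c * (2 * Q * (1 + 2 * κ * t)) < 2 * c * 1 := by gcongr
  linarith

theorem positive_outside_circle_in_cone (sx sy ρ : ℝ) (hsx : 0 < sx) (hsy : 0 < sy)
    (hρ : ρ ∈ Set.Ioo (0 : ℝ) 1) (hσ : sx < sy) (r θ : ℝ) (hr : 0 < r)
    (hθ : θ ∈ Set.Icc
      (Real.pi + Real.arctan ((sy ^ 2 - sx ^ 2) / (2 * ρ * sx * sy) -
        Real.sqrt (((sy ^ 2 - sx ^ 2) / (2 * ρ * sx * sy)) ^ 2 + 1)))
      (5 * Real.pi / 4)) :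
    let c := cstar sx sy ρ
    let a : ℝ × ℝ := (c + r * Real.cos θ, c + r * Real.sin θ)
    a.1 ^ 2 + a.2 ^ 2 > 2 * c ^ 2 → 0 < K sx sy ρ a ((c, c) : ℝ × ℝ) := by
  intro c a ha
  obtain ⟨hθ1, hθ2⟩ := hθ
  have hρ0 := hρ.1
  set τ := (sy ^ 2 - sx ^ 2) / (2 * ρ * sx * sy)
  have hτ : 0 < τ := div_pos (by nlinarith) (by positivity)
  have hT : -1 ≤ τ - √(τ ^ 2 + 1) := by
    have : √(τ ^ 2 + 1) ≤ τ + 1 := Real.sqrt_le_iff.2 ⟨by linarith, by nlinarith⟩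
    linarith
  have harc : -(π / 4) ≤ arctan (τ - √(τ ^ 2 + 1)) := by
    have := arctan_strictMono.monotone hT
    rwa [arctan_neg, arctan_one] at this
  have hcos : 0 ≤ cos (2 * θ) := by
    rw [← cos_sub_two_pi]
    exact cos_nonneg_of_neg_pi_div_two_le_of_le (by linarith) (by linarith)
  have hpq := cos_sq_add_sin_sq θ
  refine K_shift_pos hsx hsy hρ hσ hr hpq ?_ ?_
  · rw [cos_two_mul] at hcos
    linarith
  · have e : (c + r * cos θ) ^ 2 + (c + r * sin θ) ^ 2 - 2 * c ^ 2
        = 2 * r * (c * (cos θ + sin θ) + r / 2) := by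
      linear_combination r ^ 2 * hpq
    have hpos : 0 < 2 * r * (c * (cos θ + sin θ) + r / 2) := by
      rw [← e]
      exact sub_pos.2 ha
    exact pos_of_mul_pos_right hpos (by positivity)
end
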